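/- For any weight sigma of K, the K-subrepresentation of ind_K^G sigma generated by f_1 has Fpbar-linear basis {f_1} ∪ {u*beta_K*f_1 : u ranging over a set of representatives of N_{n_K}/N_{n_K+1}}; in particular it has dimension q^{t_K} + 1, where t_K = 3 if K = K_0 and t_K = 1 if K = K_1. -/

import Mathlib

open scoped Classical

noncomputable section

namespace U21

/-- The arithmetic setting: `E` is the unramified quadratic extension of a non-archimedean
local field `F` of odd residue characteristic `p`, with residue field of `F` of cardinality
`q = p ^ fdeg`.  The field `E` is encoded through its valuation subring `O = o_E`, a
uniformizer `ϖ`, the maximal ideal `mI` (so that `p_E^k` is `ϖ ^ k * O`), and the nontrivial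
`F`-automorphism `conj` of `E` (which induces the `q`-power Frobenius on the residue field
of `E`, of cardinality `q ^ 2`). -/
structure Setting where
  p : ℕ
  q : ℕ
  fdeg : ℕ
  hp : p.Prime
  hodd : p ≠ 2
  hfdeg : 0 < fdeg
  hq : q = p ^ fdeg
  E : Type
  [fieldE : Field E]
  conj : E →+* E
  conj_invol : ∀ x, conj (conj x) = x
  conj_ne : conj ≠ RingHom.id E
  O : Subring E
  val_ring : ∀ x : E, x ≠ 0 → x ∈ O ∨ x⁻¹ ∈ O
  conj_O : ∀ x, x ∈ O → conj x ∈ O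
  ϖ : E
  unif_mem : ϖ ∈ O
  unif_ne : ϖ ≠ 0
  unif_conj : conj ϖ = ϖ
  unif_not_unit : ¬ IsUnit (⟨ϖ, unif_mem⟩ : O)
  disc : ∀ x : E, x ≠ 0 → ∃ (n : ℤ) (u : Oˣ), x = (u : O) * ϖ ^ n
  mI : Ideal O
  hmI : ∀ x : O, x ∈ mI ↔ ∃ y ∈ O, (x : E) = ϖ * y
  [fin_res : Fintype (O ⧸ mI)]
  card_res : Fintype.card (O ⧸ mI) = q ^ 2
  res_frob : ∀ x : O, Ideal.Quotient.mk mI ⟨conj x, conj_O x x.2⟩ = (Ideal.Quotient.mk mI x) ^ q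
  complete : ∀ a : ℕ → E,
    (∀ k : ℕ, ∃ N, ∀ m ≥ N, ∀ n ≥ N, ∃ w ∈ O, a m - a n = ϖ ^ k * w) →
    ∃ L : E, ∀ k : ℕ, ∃ N, ∀ n ≥ N, ∃ w ∈ O, a n - L = ϖ ^ k * w

attribute [instance] Setting.fieldE Setting.fin_res

namespace Setting

variable (S : Setting)

/-- 3×3 matrices over `E`. -/
abbrev M3 := Matrix (Fin 3) (Fin 3) S.E

/-- The antidiagonal matrix `β` of the Hermitian form. -/
def betaM : S.M3 := !![0,0,1;0,1,0;1,0,0]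

/-- The fractional ideal `p_E ^ k ⊆ E` (for `k : ℤ`). -/
def pE (k : ℤ) : Set S.E := {z | ∃ w ∈ S.O, z = S.ϖ ^ k * w}

/-- The unramified unitary group `G = U(2,1)(E/F)`, as a subgroup of `GL₃(E)`:
`g ∈ G` iff `g.transpose * β * conj g = β`. -/
def Gsub : Subgroup (Matrix.GeneralLinearGroup (Fin 3) S.E) where
  carrier := {g | ((g : S.M3)).transpose * S.betaM * ((g : S.M3).map S.conj) = S.betaM}
  one_mem' := by
    simp [Matrix.map_one (⇑S.conj) (map_zero S.conj) (map_one S.conj)]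
  mul_mem' := by
    intro a b ha hb
    simp only [Set.mem_setOf_eq, Units.val_mul, Matrix.transpose_mul, Matrix.map_mul] at ha hb ⊢
    calc ((b : S.M3)).transpose * ((a : S.M3)).transpose * S.betaM * ((a : S.M3).map S.conj * (b : S.M3).map S.conj)
        = ((b : S.M3)).transpose * (((a : S.M3)).transpose * S.betaM * (a : S.M3).map S.conj) * ((b : S.M3).map S.conj) := by
          simp only [mul_assoc]
      _ = S.betaM := by rw [ha]; exact hb
  inv_mem' := by
    intro a ha
    simp only [Set.mem_setOf_eq] at ha ⊢
    have hA : IsUnit ((a : S.M3)) := a.isUnit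
    have hdet : IsUnit ((a : S.M3)).det := (Matrix.isUnit_iff_isUnit_det _).mp hA
    have hAc : IsUnit (((a : S.M3)).map ⇑S.conj) := by
      rw [← RingHom.mapMatrix_apply]; exact hA.map _
    have hdetc : IsUnit ((((a : S.M3)).map ⇑S.conj).det) := (Matrix.isUnit_iff_isUnit_det _).mp hAc
    have hdetT : IsUnit ((((a : S.M3)).transpose).det) := by rw [Matrix.det_transpose]; exact hdet
    have hmapinv : ((a : S.M3)⁻¹).map ⇑S.conj = (((a : S.M3)).map ⇑S.conj)⁻¹ := by
      symm
      apply Matrix.inv_eq_left_inv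
      rw [← Matrix.map_mul, Matrix.nonsing_inv_mul _ hdet,
        Matrix.map_one (⇑S.conj) (map_zero S.conj) (map_one S.conj)]
    rw [Matrix.coe_units_inv, Matrix.transpose_nonsing_inv, hmapinv]
    conv_lhs => rw [← ha]
    calc (((a:S.M3)).transpose)⁻¹ * (((a:S.M3)).transpose * S.betaM * ((a:S.M3)).map ⇑S.conj) * (((a:S.M3)).map ⇑S.conj)⁻¹
        = (((a:S.M3)).transpose)⁻¹ * ((a:S.M3)).transpose * S.betaM *
            (((a:S.M3)).map ⇑S.conj * (((a:S.M3)).map ⇑S.conj)⁻¹) := by simp only [mul_assoc]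
      _ = S.betaM := by
          rw [Matrix.nonsing_inv_mul _ hdetT, Matrix.mul_nonsing_inv _ hdetc, one_mul, mul_one]

/-- The group `G = U(2,1)(E/F)`. -/
abbrev GG := ↥S.Gsub

/-- The matrix of an element of `G`. -/
def mat (g : S.GG) : S.M3 := ((g : Matrix.GeneralLinearGroup (Fin 3) S.E) : S.M3)

/-- The upper unipotent matrix `n(x,y)`. -/
def nM (x y : S.E) : S.M3 := !![1, x, y; 0, 1, -S.conj x; 0, 0, 1]

/-- The lower unipotent matrix `n'(x,y)`. -/
def n'M (x y : S.E) : S.M3 := !![1, 0, 0; x, 1, 0; y, -S.conj x, 1]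

/-- The diagonal matrix `h(x) = diag(x, -x̄x⁻¹, x̄⁻¹)`. -/
def hM (x : S.E) : S.M3 := !![x, 0, 0; 0, -S.conj x * x⁻¹, 0; 0, 0, (S.conj x)⁻¹]

/-- The subgroup `N` of `G` (unipotent radical of the upper triangular Borel), as a set. -/
def Nset : Set S.GG := {g | ∃ x y : S.E, x * S.conj x + y + S.conj y = 0 ∧ S.mat g = S.nM x y}

/-- The subgroup `N_k = {n(x,y) : y ∈ p_E^k}`, as a set. -/
def Nk (k : ℤ) : Set S.GG :=
  {g | ∃ x y : S.E, x * S.conj x + y + S.conj y = 0 ∧ y ∈ S.pE k ∧ S.mat g = S.nM x y}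

/-- The subgroup `N'` of `G`, as a set. -/
def N'set : Set S.GG := {g | ∃ x y : S.E, x * S.conj x + y + S.conj y = 0 ∧ S.mat g = S.n'M x y}

/-- The subgroup `N'_k = {n'(x,y) : y ∈ p_E^k}`, as a set. -/
def N'k (k : ℤ) : Set S.GG :=
  {g | ∃ x y : S.E, x * S.conj x + y + S.conj y = 0 ∧ y ∈ S.pE k ∧ S.mat g = S.n'M x y}

/-- The diagonal subgroup `H` of `G`, as a set. -/
def Hset : Set S.GG := {g | ∃ a b c : S.E, S.mat g = !![a,0,0;0,b,0;0,0,c]}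

/-- The hyperspecial maximal compact subgroup `K₀ = G ∩ GL₃(o_E)`, as a set. -/
def K0set : Set S.GG := {g | ∀ i j, S.mat g i j ∈ S.O}

/-- The special (non-hyperspecial) maximal compact subgroup `K₁`, as a set. -/
def K1set : Set S.GG :=
  {g | S.mat g 0 0 ∈ S.O ∧ S.mat g 0 1 ∈ S.O ∧ S.mat g 0 2 ∈ S.pE (-1) ∧
       S.mat g 1 0 ∈ S.pE 1 ∧ S.mat g 1 1 ∈ S.O ∧ S.mat g 1 2 ∈ S.O ∧
       S.mat g 2 0 ∈ S.pE 1 ∧ S.mat g 2 1 ∈ S.pE 1 ∧ S.mat g 2 2 ∈ S.O}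

/-- The Iwahori subgroup `I_{K₀}` (preimage of the Borel of `Γ_{K₀}`), as a set. -/
def IK0 : Set S.GG :=
  {g | g ∈ S.K0set ∧ S.mat g 1 0 ∈ S.pE 1 ∧ S.mat g 2 0 ∈ S.pE 1 ∧ S.mat g 2 1 ∈ S.pE 1}

/-- The pro-p Iwahori subgroup `I_{1,K₀}`, as a set. -/
def I1K0 : Set S.GG :=
  {g | g ∈ S.IK0 ∧ S.mat g 0 0 - 1 ∈ S.pE 1 ∧ S.mat g 1 1 - 1 ∈ S.pE 1 ∧ S.mat g 2 2 - 1 ∈ S.pE 1}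

/-- The opposite pro-p Iwahori subgroup `I'_{1,K₀}`, as a set. -/
def I1'K0 : Set S.GG :=
  {g | g ∈ S.K0set ∧ S.mat g 0 1 ∈ S.pE 1 ∧ S.mat g 0 2 ∈ S.pE 1 ∧ S.mat g 1 2 ∈ S.pE 1 ∧
       S.mat g 0 0 - 1 ∈ S.pE 1 ∧ S.mat g 1 1 - 1 ∈ S.pE 1 ∧ S.mat g 2 2 - 1 ∈ S.pE 1}

/-- The maximal normal pro-p subgroup `K₀¹` of `K₀` (principal congruence subgroup), as a set. -/
def Kone0 : Set S.GG := {g | ∀ i j, S.mat g i j - (1 : S.M3) i j ∈ S.pE 1}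

/-- The Iwahori subgroup `I_{K₁}`, as a set. -/
def IK1 : Set S.GG := {g | g ∈ S.K1set ∧ S.mat g 2 0 ∈ S.pE 2}

/-- The pro-p Iwahori subgroup `I_{1,K₁}`, as a set. -/
def I1K1 : Set S.GG :=
  {g | g ∈ S.IK1 ∧ S.mat g 0 0 - 1 ∈ S.pE 1 ∧ S.mat g 1 1 - 1 ∈ S.pE 1 ∧ S.mat g 2 2 - 1 ∈ S.pE 1}

/-- The opposite pro-p Iwahori subgroup `I'_{1,K₁}`, as a set. -/
def I1'K1 : Set S.GG :=
  {g | g ∈ S.K1set ∧ S.mat g 0 2 ∈ S.O ∧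
       S.mat g 0 0 - 1 ∈ S.pE 1 ∧ S.mat g 1 1 - 1 ∈ S.pE 1 ∧ S.mat g 2 2 - 1 ∈ S.pE 1}

/-- The maximal normal pro-p subgroup `K₁¹` of `K₁`, as a set. -/
def Kone1 : Set S.GG :=
  {g | g ∈ S.K1set ∧ S.mat g 0 2 ∈ S.O ∧ S.mat g 2 0 ∈ S.pE 2 ∧
       S.mat g 0 0 - 1 ∈ S.pE 1 ∧ S.mat g 1 1 - 1 ∈ S.pE 1 ∧ S.mat g 2 2 - 1 ∈ S.pE 1}

/-- The congruence subgroup of level `n` (used to express smoothness), as a set. -/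
def cong (n : ℕ) : Set S.GG := {g | ∀ i j, S.mat g i j - (1 : S.M3) i j ∈ S.pE n}

def alphaM : S.M3 := !![S.ϖ⁻¹, 0, 0; 0, 1, 0; 0, 0, S.ϖ]

def alphaMinv : S.M3 := !![S.ϖ, 0, 0; 0, 1, 0; 0, 0, S.ϖ⁻¹]

lemma alpha_mul_inv : S.alphaM * S.alphaMinv = 1 := by
  ext i j
  fin_cases i <;> fin_cases j <;>
    simp [alphaM, alphaMinv, Matrix.mul_apply, Fin.sum_univ_three, Matrix.one_apply,
      Matrix.vecHead, Matrix.vecTail, inv_mul_cancel₀ S.unif_ne, mul_inv_cancel₀ S.unif_ne]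

lemma alpha_inv_mul : S.alphaMinv * S.alphaM = 1 := by
  ext i j
  fin_cases i <;> fin_cases j <;>
    simp [alphaM, alphaMinv, Matrix.mul_apply, Fin.sum_univ_three, Matrix.one_apply,
      Matrix.vecHead, Matrix.vecTail, inv_mul_cancel₀ S.unif_ne, mul_inv_cancel₀ S.unif_ne]

def alphaU : Matrix.GeneralLinearGroup (Fin 3) S.E :=
  ⟨S.alphaM, S.alphaMinv, S.alpha_mul_inv, S.alpha_inv_mul⟩

lemma alphaU_mem : S.alphaU ∈ S.Gsub := by
  show ((S.alphaU : S.M3)).transpose * S.betaM * ((S.alphaU : S.M3).map S.conj) = S.betaM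
  have : (S.alphaU : S.M3) = S.alphaM := rfl
  rw [this]
  ext i j
  fin_cases i <;> fin_cases j <;>
    simp [alphaM, betaM, Matrix.mul_apply, Fin.sum_univ_three, Matrix.map_apply,
      Matrix.transpose_apply, Matrix.vecHead, Matrix.vecTail, map_inv₀, S.unif_conj,
      inv_mul_cancel₀ S.unif_ne, mul_inv_cancel₀ S.unif_ne]

/-- The element `α = diag(ϖ⁻¹, 1, ϖ)` of `G`. -/
def alphaE : S.GG := ⟨S.alphaU, S.alphaU_mem⟩

lemma beta_mul_beta : S.betaM * S.betaM = 1 := by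
  ext i j
  fin_cases i <;> fin_cases j <;>
    simp [betaM, Matrix.mul_apply, Fin.sum_univ_three, Matrix.one_apply,
      Matrix.vecHead, Matrix.vecTail]

def betaU : Matrix.GeneralLinearGroup (Fin 3) S.E :=
  ⟨S.betaM, S.betaM, S.beta_mul_beta, S.beta_mul_beta⟩

lemma betaU_mem : S.betaU ∈ S.Gsub := by
  show ((S.betaU : S.M3)).transpose * S.betaM * ((S.betaU : S.M3).map S.conj) = S.betaM
  have : (S.betaU : S.M3) = S.betaM := rfl
  rw [this]
  ext i j
  fin_cases i <;> fin_cases j <;>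
    simp [betaM, Matrix.mul_apply, Fin.sum_univ_three, Matrix.map_apply, Matrix.transpose_apply,
      Matrix.vecHead, Matrix.vecTail]

/-- The element `β` of `G`. -/
def betaE : S.GG := ⟨S.betaU, S.betaU_mem⟩

/-- The element `β' = β * α⁻¹` of `G`. -/
def betaPr : S.GG := S.betaE * S.alphaE⁻¹

/-- A finite set `U` is a set of representatives for the cosets `A/B`. -/
def IsReps (A B : Set S.GG) (U : Finset S.GG) : Prop :=
  (↑U : Set S.GG) ⊆ A ∧ ∀ a ∈ A, ∃! u, u ∈ U ∧ a⁻¹ * u ∈ B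

/-- The residue field `k_E` of `E`. -/
abbrev kE := S.O ⧸ S.mI

/-- The residue map `o_E → k_E`. -/
def resmap : S.O →+* S.kE := Ideal.Quotient.mk S.mI

/-- The group `L_{q³} = {(x,t) ∈ k_E² : x x̄ + t + t̄ = 0}` (where `x̄ = x^q`). -/
def Lbig : Set (S.kE × S.kE) := {z | z.1 * z.1 ^ S.q + z.2 + z.2 ^ S.q = 0}

/-- The group `L_q = {(0,t) ∈ k_E² : t + t̄ = 0}`. -/
def Lsmall : Set (S.kE × S.kE) := {z | z.1 = 0 ∧ z.2 + z.2 ^ S.q = 0}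

/-- `L_{q^t}` for `t ∈ {1,3}`. -/
def Lof (t : ℕ) : Set (S.kE × S.kE) := if t = 3 then S.Lbig else S.Lsmall

end Setting

/-- A choice of one of the two maximal compact open subgroups `K ∈ {K₀, K₁}` of `G`,
together with its maximal normal pro-p subgroup `K¹`, the (pro-p) Iwahori subgroups
`I_K ⊇ I_{1,K}`, the opposite pro-p Iwahori `I'_{1,K}`, the element
`β_K ∈ K ∩ {β, β'}`, and the integers `n_K, m_K, t_K`. -/
structure Chamber (S : Setting) where
  K : Subgroup S.GG
  KoneS : Set S.GG
  IK : Set S.GG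
  I1 : Set S.GG
  I1' : Set S.GG
  βK : S.GG
  nK : ℤ
  mK : ℤ
  tK : ℕ
  cases :
    ((K : Set S.GG) = S.K0set ∧ KoneS = S.Kone0 ∧ IK = S.IK0 ∧ I1 = S.I1K0 ∧ I1' = S.I1'K0 ∧
      βK = S.betaE ∧ nK = 0 ∧ mK = 1 ∧ tK = 3) ∨
    ((K : Set S.GG) = S.K1set ∧ KoneS = S.Kone1 ∧ IK = S.IK1 ∧ I1 = S.I1K1 ∧ I1' = S.I1'K1 ∧
      βK = S.betaPr ∧ nK = -1 ∧ mK = 2 ∧ tK = 1)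

namespace Chamber

variable {S : Setting} (C : Chamber S)

/-- `H₀ = H ∩ I_K`. -/
def H0 : Set S.GG := S.Hset ∩ C.IK

/-- `H₁ = H ∩ I_{1,K}`. -/
def H1 : Set S.GG := S.Hset ∩ C.I1

end Chamber

section RepTheory

variable {S : Setting} (C : Chamber S)
variable (𝔽 : Type) [Field 𝔽]

section Generic

variable {G₀ : Type} [Monoid G₀] {V : Type} [AddCommGroup V] [Module 𝔽 V]

/-- A submodule is invariant under a representation. -/
def Invt (ρ : Representation 𝔽 G₀ V) (Ssub : Submodule 𝔽 V) : Prop :=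
  ∀ g v, v ∈ Ssub → ρ g v ∈ Ssub

/-- The subrepresentation generated by a vector (the span of its orbit). -/
def orbitSpan (ρ : Representation 𝔽 G₀ V) (v : V) : Submodule 𝔽 V :=
  Submodule.span 𝔽 {w | ∃ g, w = ρ g v}

/-- The subrepresentation generated by a vector under a subset `A` of the group. -/
def orbitSpanOn (ρ : Representation 𝔽 G₀ V) (A : Set G₀) (v : V) : Submodule 𝔽 V :=
  Submodule.span 𝔽 {w | ∃ g ∈ A, w = ρ g v}

/-- The quotient of a representation by an invariant submodule `N` is irreducible:
equivalently (by the lattice correspondence), `N ≠ ⊤` and any invariant submodule lying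
between `N` and `⊤` equals `N` or `⊤`. -/
def QuotientIrreducible (ρ : Representation 𝔽 G₀ V) (N : Submodule 𝔽 V) : Prop :=
  N ≠ ⊤ ∧ ∀ Ssub : Submodule 𝔽 V, Invt 𝔽 ρ Ssub → N ≤ Ssub → Ssub = N ∨ Ssub = ⊤

/-- The submodule of vectors invariant under all elements of the subset `A`. -/
def invariantsOn (ρ : Representation 𝔽 G₀ V) (A : Set G₀) : Submodule 𝔽 V where
  carrier := {v | ∀ g ∈ A, ρ g v = v}
  add_mem' := by
    intro a b ha hb g hg
    rw [map_add, ha g hg, hb g hg]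
  zero_mem' := by
    intro g hg
    rw [map_zero]
  smul_mem' := by
    intro c a ha g hg
    rw [map_smul, ha g hg]

/-- The space `Hom_G(ρ₁, ρ₂)` of equivariant linear maps, as a submodule of the linear maps. -/
def EquivHomSub {V₂ : Type} [AddCommGroup V₂] [Module 𝔽 V₂]
    (ρ₁ : Representation 𝔽 G₀ V) (ρ₂ : Representation 𝔽 G₀ V₂) :
    Submodule 𝔽 (V →ₗ[𝔽] V₂) where
  carrier := {φ | ∀ g x, φ (ρ₁ g x) = ρ₂ g (φ x)}
  add_mem' := by
    intro a b ha hb g x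
    simp only [LinearMap.add_apply, ha g x, hb g x, map_add]
  zero_mem' := by
    intro g x
    simp only [LinearMap.zero_apply, map_zero]
  smul_mem' := by
    intro c a ha g x
    simp only [LinearMap.smul_apply, ha g x, map_smul]

end Generic

section Weight

variable (W : Type) [AddCommGroup W] [Module 𝔽 W]
variable (σ : Representation 𝔽 ↥C.K W)

/-- Extension of `σ` to all of `G` (by `1` outside `K`); used to avoid coercion issues. -/
def sigma' : S.GG → Module.End 𝔽 W := fun g => if h : g ∈ C.K then σ ⟨g, h⟩ else 1

/-- `σ` is a weight of `K`: an irreducible smooth representation of `K` over `𝔽`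
factoring through `Γ_K = K / K¹` (automatically finite dimensional). -/
def IsWeight : Prop :=
  Nontrivial W ∧ FiniteDimensional 𝔽 W ∧
  (∀ Ssub : Submodule 𝔽 W, (∀ (k : ↥C.K) (w : W), w ∈ Ssub → σ k w ∈ Ssub) → Ssub = ⊥ ∨ Ssub = ⊤) ∧
  (∀ (g : S.GG) (hg : g ∈ C.K), g ∈ C.KoneS → σ ⟨g, hg⟩ = LinearMap.id)

/-- `σ` is one dimensional of the form `χ ∘ det`. -/
def IsDetWeight : Prop :=
  Module.finrank 𝔽 W = 1 ∧
  ∃ c : S.E → 𝔽, ∀ (g : S.GG) (hg : g ∈ C.K) (w : W), σ ⟨g, hg⟩ w = c ((S.mat g).det) • w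

/-- `j_σ : σ → σ` is the composition of the coinvariant projection `σ → σ_{I'_{1,K}}`
with the inverse of the natural isomorphism `σ^{I_{1,K}} ≅ σ_{I'_{1,K}}`:
it restricts to the identity on `σ^{I_{1,K}}` and kills the augmentation part of
`σ` with respect to `I'_{1,K}`. -/
def IsJ (jσ : W →ₗ[𝔽] W) : Prop :=
  (∀ w : W, (∀ g ∈ C.I1, sigma' C 𝔽 W σ g w = w) → jσ w = w) ∧
  (∀ (w : W) (g : S.GG), g ∈ C.I1' → jσ (sigma' C 𝔽 W σ g w - w) = 0)

/-- The defining conditions of the compact induction `ind_K^G σ`: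
`K`-equivariance on the left and compact support (finitely many cosets `K g`). -/
def IndCarrier : Set (S.GG → W) :=
  {f | (∀ (k : S.GG) (hk : k ∈ C.K) (g : S.GG), f (k * g) = σ ⟨k, hk⟩ (f g)) ∧
       ∃ s : Finset S.GG, ∀ g : S.GG, f g ≠ 0 → ∃ k ∈ C.K, ∃ t ∈ s, g = k * t}

/-- The compact induction `ind_K^G σ`, as a submodule of `G → W`. -/
def IndSub : Submodule 𝔽 (S.GG → W) where
  carrier := IndCarrier C 𝔽 W σ
  add_mem' := by
    rintro f g ⟨hf1, sf, hf2⟩ ⟨hg1, sg, hg2⟩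
    refine ⟨fun k hk x => by simp [hf1 k hk x, hg1 k hk x], sf ∪ sg, fun x hx => ?_⟩
    by_cases h : f x ≠ 0
    · obtain ⟨k, hk, t, ht, rfl⟩ := hf2 x h
      exact ⟨k, hk, t, Finset.mem_union_left _ ht, rfl⟩
    · push_neg at h
      have hgx : g x ≠ 0 := by
        intro h0
        apply hx
        simp [Pi.add_apply, h, h0]
      obtain ⟨k, hk, t, ht, rfl⟩ := hg2 x hgx
      exact ⟨k, hk, t, Finset.mem_union_right _ ht, rfl⟩
  zero_mem' := ⟨fun k hk g => by simp, ∅, fun g hg => absurd rfl hg⟩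
  smul_mem' := by
    rintro c f ⟨hf1, sf, hf2⟩
    refine ⟨fun k hk g => by simp [hf1 k hk g], sf, fun x hx => ?_⟩
    refine hf2 x ?_
    intro h0
    apply hx
    simp [h0]

lemma indAct_mem (g : S.GG) {f : S.GG → W} (hf : f ∈ IndCarrier C 𝔽 W σ) :
    (fun x => f (x * g)) ∈ IndCarrier C 𝔽 W σ := by
  obtain ⟨h1, s, h2⟩ := hf
  refine ⟨fun k hk x => ?_, s.image (· * g⁻¹), ?_⟩
  · show f (k * x * g) = _
    rw [mul_assoc]
    exact h1 k hk (x * g)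
  intro x hx
  obtain ⟨k, hk, t, ht, hxg⟩ := h2 (x * g) hx
  refine ⟨k, hk, t * g⁻¹, Finset.mem_image_of_mem _ ht, ?_⟩
  rw [← mul_assoc, ← hxg, mul_assoc, mul_inv_cancel, mul_one]

/-- The representation of `G` on `ind_K^G σ` by right translation. -/
def indRep : Representation 𝔽 S.GG ↥(IndSub C 𝔽 W σ) where
  toFun g :=
    { toFun := fun f => ⟨fun x => (f : S.GG → W) (x * g), indAct_mem C 𝔽 W σ g f.2⟩
      map_add' := fun f1 f2 => Subtype.ext (funext fun x => rfl)
      map_smul' := fun c f => Subtype.ext (funext fun x => rfl) }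
  map_one' := LinearMap.ext fun f => Subtype.ext (funext fun x => by simp [mul_one])
  map_mul' g h := LinearMap.ext fun f => Subtype.ext (funext fun x => by simp [mul_assoc])

/-- The function `[g, v] ∈ ind_K^G σ`: supported on `K g⁻¹`, with value `v` at `g⁻¹`. -/
def stdFn (g : S.GG) (v : W) : S.GG → W :=
  fun x => if h : x * g ∈ C.K then σ ⟨x * g, h⟩ v else 0

/-- The characterization of the family `f_n` (`n ∈ ℤ`) of `I_{1,K}`-invariant elements of
`ind_K^G σ`: `f_n` is supported on `K α⁻ⁿ I_{1,K}` and has value at `α⁻ⁿ` equal to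
`σ(β_K) v₀` for `n > 0` and `v₀` for `n ≤ 0`, where `v₀` is a fixed nonzero vector of
`σ^{I_{1,K}}`. -/
def IsFFamily (v0 : W) (ff : ℤ → ↥(IndSub C 𝔽 W σ)) : Prop :=
  v0 ≠ 0 ∧ (∀ g ∈ C.I1, sigma' C 𝔽 W σ g v0 = v0) ∧
  (∀ (n : ℤ) (g : S.GG), g ∈ C.I1 → indRep C 𝔽 W σ g (ff n) = ff n) ∧
  (∀ (n : ℤ) (x : S.GG), (ff n : S.GG → W) x ≠ 0 →
    ∃ k ∈ C.K, ∃ i ∈ C.I1, x = k * S.alphaE ^ (-n) * i) ∧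
  (∀ n : ℤ, 0 < n → (ff n : S.GG → W) (S.alphaE ^ (-n)) = sigma' C 𝔽 W σ C.βK v0) ∧
  (∀ n : ℤ, n ≤ 0 → (ff n : S.GG → W) (S.alphaE ^ (-n)) = v0)

/-- The characterization of the Hecke operator `T ∈ End_G(ind_K^G σ)`:
it is `G`-equivariant and satisfies
`T [1, v] = ∑_{u ∈ N_{n_K}/N_{n_K+2}} [u α⁻¹, j_σ σ(u⁻¹) v]
  + ∑_{u ∈ N_{n_K+1}/N_{n_K+2}} [β_K u α⁻¹, j_σ σ(β_K) v]`. -/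
def IsHeckeT (jσ : W →ₗ[𝔽] W) (T : Module.End 𝔽 ↥(IndSub C 𝔽 W σ)) : Prop :=
  (∀ (g : S.GG) (x : ↥(IndSub C 𝔽 W σ)),
    T (indRep C 𝔽 W σ g x) = indRep C 𝔽 W σ g (T x)) ∧
  (∀ (v : W) (x : ↥(IndSub C 𝔽 W σ)), (x : S.GG → W) = stdFn C 𝔽 W σ 1 v →
    ∀ (U2 U1 : Finset S.GG),
      S.IsReps (S.Nk C.nK) (S.Nk (C.nK + 2)) U2 →
      S.IsReps (S.Nk (C.nK + 1)) (S.Nk (C.nK + 2)) U1 →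
      ((T x : S.GG → W)) =
        (∑ u ∈ U2, stdFn C 𝔽 W σ (u * S.alphaE⁻¹) (jσ (sigma' C 𝔽 W σ u⁻¹ v))) +
        ∑ u ∈ U1, stdFn C 𝔽 W σ (C.βK * u * S.alphaE⁻¹) (jσ (sigma' C 𝔽 W σ C.βK v)))

/-- The eigencharacter `χ_σ` of `H₀/H₁` afforded by the (one-dimensional) space
`σ^{I_{1,K}}` with chosen basis vector `v₀`. -/
def IsChi (v0 : W) (χ : S.GG → 𝔽) : Prop :=
  (∀ h ∈ C.H0, sigma' C 𝔽 W σ h v0 = χ h • v0)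

/-- Right translation on functions `K → 𝔽` (the action on a (finite) principal series). -/
def PSact (k : ↥C.K) (f : ↥C.K → 𝔽) : ↥C.K → 𝔽 := fun x => f (x * k)

/-- The (inflation to `K` of the) finite principal series `Ind_𝔹^{Γ_K} χ`:
functions on `K`, invariant under right translation by `K¹`, left `I_{1,K}`-invariant and
left `(H₀, χ)`-equivariant. -/
def PSchiSub (χ : S.GG → 𝔽) : Submodule 𝔽 (↥C.K → 𝔽) where
  carrier := {f | (∀ b : ↥C.K, (b : S.GG) ∈ C.I1 → ∀ x, f (b * x) = f x) ∧
                  (∀ h : ↥C.K, (h : S.GG) ∈ C.H0 → ∀ x, f (h * x) = χ (h : S.GG) * f x) ∧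
                  (∀ z : ↥C.K, (z : S.GG) ∈ C.KoneS → ∀ x, f (x * z) = f x)}
  add_mem' := by
    rintro f g ⟨hf1, hf2, hf3⟩ ⟨hg1, hg2, hg3⟩
    exact ⟨fun b hb x => by simp [hf1 b hb x, hg1 b hb x],
           fun h hh x => by simp [hf2 h hh x, hg2 h hh x, mul_add],
           fun z hz x => by simp [hf3 z hz x, hg3 z hz x]⟩
  zero_mem' := ⟨fun b hb x => rfl, fun h hh x => by simp, fun z hz x => rfl⟩
  smul_mem' := by
    rintro c f ⟨hf1, hf2, hf3⟩
    refine ⟨fun b hb x => by simp [hf1 b hb x], fun h hh x => ?_, fun z hz x => by simp [hf3 z hz x]⟩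
    simp only [Pi.smul_apply, hf2 h hh x, smul_eq_mul]
    ring

/-- The principal series `Ind_𝔹^{Γ_K} 1` for the trivial character. -/
def PS1sub : Submodule 𝔽 (↥C.K → 𝔽) := PSchiSub C 𝔽 (fun _ => 1)

/-- `σ_{st}` is the Steinberg weight `st = (Ind_𝔹^{Γ_K} 1)/1`: there is a surjective
`K`-equivariant linear map from `Ind_𝔹^{Γ_K} 1` to it whose kernel is exactly the
constant functions. -/
def IsSteinberg {Wst : Type} [AddCommGroup Wst] [Module 𝔽 Wst]
    (σst : Representation 𝔽 ↥C.K Wst) : Prop :=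
  ∃ φ : ↥(PS1sub C 𝔽) →ₗ[𝔽] Wst, Function.Surjective φ ∧
    (∀ f : ↥(PS1sub C 𝔽), φ f = 0 ↔ ∃ c : 𝔽, (f : ↥C.K → 𝔽) = fun _ => c) ∧
    (∀ (k : ↥C.K) (f f' : ↥(PS1sub C 𝔽)),
      (f' : ↥C.K → 𝔽) = PSact C 𝔽 k (f : ↥C.K → 𝔽) → φ f' = σst k (φ f))

/-- `σ` is isomorphic to a twist of the Steinberg weight by a character. -/
def IsTwistSteinberg : Prop :=
  ∃ (c : ↥C.K →* 𝔽ˣ) (φ : ↥(PS1sub C 𝔽) →ₗ[𝔽] W), Function.Surjective φ ∧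
    (∀ f : ↥(PS1sub C 𝔽), φ f = 0 ↔ ∃ cc : 𝔽, (f : ↥C.K → 𝔽) = fun _ => cc) ∧
    (∀ (k : ↥C.K) (f f' : ↥(PS1sub C 𝔽)),
      (f' : ↥C.K → 𝔽) = PSact C 𝔽 k (f : ↥C.K → 𝔽) →
        φ f' = (c k : 𝔽) • σ k (φ f))


/-- The `K`-subrepresentation of the quotient `(ind_K^G σ) / (range T)` generated by the
image of a vector `v`. -/
def genQuot (T : Module.End 𝔽 ↥(IndSub C 𝔽 W σ)) (v : ↥(IndSub C 𝔽 W σ)) :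
    Submodule 𝔽 (↥(IndSub C 𝔽 W σ) ⧸ LinearMap.range T) :=
  Submodule.span 𝔽 {w | ∃ k ∈ C.K, w = Submodule.Quotient.mk (indRep C 𝔽 W σ k v)}

end Weight

/-- Smoothness of a representation of `G`: every vector is fixed by some congruence
subgroup (equivalently, has open stabilizer). -/
def SmoothRep {V : Type} [AddCommGroup V] [Module 𝔽 V] (ρ : Representation 𝔽 S.GG V) : Prop :=
  ∀ v : V, ∃ n : ℕ, ∀ g ∈ S.cong n, ρ g v = v

end RepTheory

end U21

namespace U21

namespace Setting

variable (S : Setting)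

lemma mem_pE_iff {k : ℤ} {z : S.E} : z ∈ S.pE k ↔ z * S.ϖ ^ (-k) ∈ S.O := by
  have h0 : S.ϖ ^ k ≠ 0 := zpow_ne_zero k S.unif_ne
  constructor
  · rintro ⟨w, hw, rfl⟩
    rwa [zpow_neg, mul_right_comm, mul_inv_cancel₀ h0, one_mul]
  · intro h
    refine ⟨_, h, ?_⟩
    rw [zpow_neg, mul_left_comm, mul_inv_cancel₀ h0, mul_one]

lemma mem_pE_zero {z : S.E} : z ∈ S.pE 0 ↔ z ∈ S.O := by
  simp [mem_pE_iff]

variable {S}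

lemma pE_zero (k : ℤ) : (0 : S.E) ∈ S.pE k := by
  simp [mem_pE_iff, S.O.zero_mem]

lemma pE_add {k : ℤ} {z w : S.E} (hz : z ∈ S.pE k) (hw : w ∈ S.pE k) : z + w ∈ S.pE k := by
  rw [mem_pE_iff] at *
  rw [add_mul]
  exact S.O.add_mem hz hw

lemma pE_neg {k : ℤ} {z : S.E} (hz : z ∈ S.pE k) : -z ∈ S.pE k := by
  rw [mem_pE_iff] at *
  rw [neg_mul]
  exact S.O.neg_mem hz

lemma pE_sub {k : ℤ} {z w : S.E} (hz : z ∈ S.pE k) (hw : w ∈ S.pE k) : z - w ∈ S.pE k := by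
  rw [sub_eq_add_neg]
  exact pE_add hz (pE_neg hw)

lemma pE_mono {k l : ℤ} (h : l ≤ k) {z : S.E} (hz : z ∈ S.pE k) : z ∈ S.pE l := by
  rw [mem_pE_iff] at *
  have : z * S.ϖ ^ (-l) = z * S.ϖ ^ (-k) * S.ϖ ^ (k - l).toNat := by
    rw [← zpow_natCast, Int.toNat_of_nonneg (by omega), mul_assoc, ← zpow_add₀ S.unif_ne]
    congr 2
    ring
  rw [this]
  exact S.O.mul_mem hz (S.O.pow_mem S.unif_mem _)

lemma pE_mul {k l m : ℤ} {z w : S.E} (hz : z ∈ S.pE k) (hw : w ∈ S.pE l) (h : m ≤ k + l) :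
    z * w ∈ S.pE m := by
  refine pE_mono h ?_
  rw [mem_pE_iff] at *
  have : z * w * S.ϖ ^ (-(k + l)) = (z * S.ϖ ^ (-k)) * (w * S.ϖ ^ (-l)) := by
    rw [neg_add, zpow_add₀ S.unif_ne]
    ring
  rw [this]
  exact S.O.mul_mem hz hw

lemma conj_zpow (k : ℤ) : S.conj (S.ϖ ^ k) = S.ϖ ^ k := by
  rw [map_zpow₀, S.unif_conj]

lemma pE_conj {k : ℤ} {z : S.E} (hz : z ∈ S.pE k) : S.conj z ∈ S.pE k := by
  rw [mem_pE_iff] at *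
  rw [← conj_zpow (-k), ← map_mul]
  exact S.conj_O _ hz

lemma pE_conj_iff {k : ℤ} {z : S.E} : S.conj z ∈ S.pE k ↔ z ∈ S.pE k :=
  ⟨fun h => by simpa only [S.conj_invol] using pE_conj h, pE_conj⟩

lemma zpow_mem_pE (k : ℤ) : S.ϖ ^ k ∈ S.pE k :=
  ⟨1, S.O.one_mem, (mul_one _).symm⟩

lemma one_mem_pE : (1 : S.E) ∈ S.pE 0 := by
  simpa using zpow_mem_pE (S := S) 0

lemma inv_unif_notMem : S.ϖ⁻¹ ∉ S.O := fun h =>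
  S.unif_not_unit (IsUnit.of_mul_eq_one (⟨S.ϖ⁻¹, h⟩ : S.O)
    (Subtype.ext (mul_inv_cancel₀ S.unif_ne)))

lemma one_notMem_pE_one : (1 : S.E) ∉ S.pE 1 := by
  rw [mem_pE_iff, one_mul, zpow_neg_one]
  exact inv_unif_notMem

/-- An element outside `p_E ^ (k + 1)` has valuation at most `k`. -/
lemma inv_mem_pE {k : ℤ} {z : S.E} (hz : z ∉ S.pE (k + 1)) : z⁻¹ ∈ S.pE (-k) := by
  have hz0 : z ≠ 0 := fun h => hz (h ▸ pE_zero _)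
  obtain ⟨n, u, rfl⟩ := S.disc z hz0
  have hn : n ≤ k := by
    by_contra hlt
    refine hz (pE_mono (l := k + 1) (k := n) (by omega) ?_)
    exact ⟨(u : S.O), (u : S.O).2, mul_comm _ _⟩
  refine pE_mono (k := -n) (by omega) ?_
  refine ⟨((u⁻¹ : S.Oˣ) : S.O), ((u⁻¹ : S.Oˣ) : S.O).2, ?_⟩
  have hu : ((u : S.O) : S.E) * (((u⁻¹ : S.Oˣ) : S.O) : S.E) = 1 := by
    rw [← S.O.coe_mul, Units.mul_inv, S.O.coe_one]
  rw [mul_inv, mul_comm, zpow_neg, inv_eq_of_mul_eq_one_right hu]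

lemma ne_zero_of_notMem_pE {k : ℤ} {z : S.E} (hz : z ∉ S.pE k) : z ≠ 0 :=
  fun h => hz (h ▸ pE_zero _)

/-- Valuations of norms are even. -/
lemma mem_pE_of_norm {k l : ℤ} (hkl : 2 * l ≤ k + 1) {x : S.E}
    (h : x * S.conj x ∈ S.pE k) : x ∈ S.pE l := by
  by_contra hx
  have hx0 := ne_zero_of_notMem_pE hx
  have hc0 : S.conj x ≠ 0 := by simpa using hx0
  have h1 : x⁻¹ ∈ S.pE (-(l - 1)) := inv_mem_pE (by simpa using hx)
  have h2 : (S.conj x)⁻¹ ∈ S.pE (-(l - 1)) := inv_mem_pE (by simpa [pE_conj_iff] using hx)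
  have h3 := pE_mul (m := 1) h (pE_mul (m := 2 - 2 * l) h1 h2 (by omega)) (by omega)
  apply one_notMem_pE_one (S := S)
  convert h3 using 1
  field_simp

lemma mem_pE_cross {k : ℤ} {x x' : S.E} (h : x * S.conj x ∈ S.pE k)
    (h' : x' * S.conj x' ∈ S.pE k) : x * S.conj x' ∈ S.pE k := by
  by_cases hx : x = 0
  · simpa [hx] using pE_zero k
  by_cases hx' : x' = 0
  · simpa [hx'] using pE_zero k
  have hc : S.conj x ≠ 0 := by simpa using hx
  rcases S.val_ring (x / x') (div_ne_zero hx hx') with hr | hr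
  · have := pE_mul (m := k) (S.mem_pE_zero.2 hr) h' (by omega)
    convert this using 1
    field_simp
  · rw [inv_div] at hr
    have := pE_mul (m := k) (pE_conj (S.mem_pE_zero.2 hr)) h (by omega)
    convert this using 1
    rw [map_div₀]
    field_simp

end Setting

namespace Setting

variable (S : Setting)

lemma mat_mul (g h : S.GG) : S.mat (g * h) = S.mat g * S.mat h := rfl

lemma mat_one : S.mat 1 = 1 := rfl

lemma mat_mul_apply (g h : S.GG) (i j : Fin 3) :
    S.mat (g * h) i j = S.mat g i 0 * S.mat h 0 j + S.mat g i 1 * S.mat h 1 j +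
      S.mat g i 2 * S.mat h 2 j := by
  rw [mat_mul, Matrix.mul_apply, Fin.sum_univ_three]

lemma mat_inj {g h : S.GG} (e : S.mat g = S.mat h) : g = h :=
  Subtype.ext (Units.ext e)

lemma mat_unitary (g : S.GG) :
    (S.mat g).transpose * S.betaM * (S.mat g).map S.conj = S.betaM := g.2

lemma betaM_apply (i j : Fin 3) : S.betaM i j = if j = Fin.rev i then 1 else 0 := by
  fin_cases i <;> fin_cases j <;> simp [betaM, Fin.rev]

lemma column_rel_of {M : S.M3} (h : M.transpose * S.betaM * M.map S.conj = S.betaM)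
    (i j : Fin 3) :
    M 0 i * S.conj (M 2 j) + M 1 i * S.conj (M 1 j) + M 2 i * S.conj (M 0 j) =
      if j = Fin.rev i then 1 else 0 := by
  rw [← betaM_apply, ← h]
  simp [betaM_apply, Matrix.mul_apply, Fin.sum_univ_three, Fin.rev]
  ring

/-- The Hermitian relations between the columns of an element of `G`. -/
lemma column_rel (g : S.GG) (i j : Fin 3) :
    S.mat g 0 i * S.conj (S.mat g 2 j) + S.mat g 1 i * S.conj (S.mat g 1 j) +
      S.mat g 2 i * S.conj (S.mat g 0 j) = if j = Fin.rev i then 1 else 0 :=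
  S.column_rel_of (S.mat_unitary g) i j

/-- The adjoint of a matrix with respect to the Hermitian form. -/
def adj (M : S.M3) : S.M3 := Matrix.of fun i j => S.conj (M (Fin.rev j) (Fin.rev i))

lemma adj_mul_self {M : S.M3} (h : M.transpose * S.betaM * M.map S.conj = S.betaM) :
    S.adj M * M = 1 := by
  ext i j
  have hij := S.column_rel_of h j (Fin.rev i)
  simp only [Fin.rev_inj] at hij
  rw [Matrix.one_apply, ← hij, Matrix.mul_apply, Fin.sum_univ_three]
  simp [adj, Fin.rev]
  ring

/-- The element of `G` with a given matrix. -/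
def ofMat (M : S.M3) (h : M.transpose * S.betaM * M.map S.conj = S.betaM) : S.GG :=
  ⟨⟨M, S.adj M, mul_eq_one_comm.1 (S.adj_mul_self h), S.adj_mul_self h⟩, h⟩

lemma mat_inv_apply (g : S.GG) (i j : Fin 3) :
    S.mat g⁻¹ i j = S.conj (S.mat g (Fin.rev j) (Fin.rev i)) := by
  have : g⁻¹ = (S.ofMat (S.mat g) g.2)⁻¹ := congrArg _ (S.mat_inj rfl)
  rw [this]
  rfl

/-- The unipotent element `n(x, y)`. -/
def nE (x y : S.E) (h : x * S.conj x + y + S.conj y = 0) : S.GG :=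
  S.ofMat (S.nM x y) (by
    ext i j
    fin_cases i <;> fin_cases j <;>
      simp [nM, betaM, Matrix.mul_apply, Fin.sum_univ_three, S.conj_invol]
    linear_combination h)

@[simp] lemma mat_nE (x y : S.E) (h) : S.mat (S.nE x y h) = S.nM x y := rfl

/-- The diagonal element `diag(a, b, conj a⁻¹)`. -/
def dE (a b : S.E) (ha : a ≠ 0) (hb : b * S.conj b = 1) : S.GG :=
  S.ofMat !![a, 0, 0; 0, b, 0; 0, 0, (S.conj a)⁻¹] (by
    have hc : S.conj a ≠ 0 := by simpa using ha
    ext i j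
    fin_cases i <;> fin_cases j <;>
      simp [betaM, Matrix.mul_apply, Fin.sum_univ_three, S.conj_invol, ha, hc, hb])

@[simp] lemma mat_dE (a b : S.E) (ha hb) :
    S.mat (S.dE a b ha hb) = !![a, 0, 0; 0, b, 0; 0, 0, (S.conj a)⁻¹] := rfl

lemma mat_alphaE_zpow (k : ℤ) :
    S.mat (S.alphaE ^ k) = !![S.ϖ ^ (-k), 0, 0; 0, 1, 0; 0, 0, S.ϖ ^ k] := by
  have h1 : S.mat S.alphaE = S.alphaM := rfl
  have h2 : S.mat S.alphaE⁻¹ = S.alphaMinv := rfl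
  induction k using Int.induction_on with
  | zero =>
    rw [zpow_zero, mat_one]
    ext i j
    fin_cases i <;> fin_cases j <;> simp
  | succ n ih =>
    rw [zpow_add_one, mat_mul, ih, h1]
    ext i j
    fin_cases i <;> fin_cases j <;>
      simp [alphaM, Matrix.mul_apply, Fin.sum_univ_three, zpow_add₀ S.unif_ne, mul_comm]
  | pred n ih =>
    rw [zpow_sub_one, mat_mul, ih, h2]
    ext i j
    fin_cases i <;> fin_cases j <;>
      simp [alphaMinv, Matrix.mul_apply, Fin.sum_univ_three, zpow_add₀ S.unif_ne,
        zpow_sub₀ S.unif_ne, mul_comm, div_eq_mul_inv]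

/-- The antidiagonal matrix representing `β_K`. -/
def sM (δ : ℤ) : S.M3 := !![0, 0, S.ϖ ^ (-δ); 0, 1, 0; S.ϖ ^ δ, 0, 0]

/-- The elements of `G` whose difference with the identity has entries of prescribed valuations. -/
def Shape (e : Matrix (Fin 3) (Fin 3) ℤ) (g : S.GG) : Prop :=
  ∀ i j, S.mat g i j - (1 : S.M3) i j ∈ S.pE (e i j)

/-- Exponents describing `K`. -/
def eK (δ : ℤ) : Matrix (Fin 3) (Fin 3) ℤ := !![0, 0, -δ; δ, 0, 0; δ, δ, 0]

/-- Exponents describing the pro-`p` Iwahori subgroup. -/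
def eI (δ : ℤ) : Matrix (Fin 3) (Fin 3) ℤ := !![1, 0, -δ; 1, 1, 0; 1 + δ, 1, 1]

/-- Exponents describing the maximal normal pro-`p` subgroup of `K`. -/
def eP (δ : ℤ) : Matrix (Fin 3) (Fin 3) ℤ := !![1, 1 - δ, 1 - δ; 1, 1, 1 - δ; 1 + δ, 1, 1]

end Setting

namespace Chamber

variable {S : Setting}

/-- A uniform description of both types of chambers by `δ = -n_K ∈ {0, 1}`. -/
structure Level (C : Chamber S) (δ : ℤ) : Prop where
  zero_or_one : δ = 0 ∨ δ = 1
  nK_eq : C.nK = -δ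
  tK_eq : (C.tK : ℤ) = 3 - 2 * δ
  mem_K : ∀ g, g ∈ C.K ↔ S.Shape (Setting.eK δ) g
  mem_I1 : ∀ g, g ∈ C.I1 ↔ S.Shape (Setting.eI δ) g
  mem_Kone : ∀ g, g ∈ C.KoneS ↔ S.Shape (Setting.eP δ) g
  mat_βK : S.mat C.βK = S.sM δ

lemma sub_one_mem_pE_zero {z : S.E} : z - 1 ∈ S.pE 0 ↔ z ∈ S.pE 0 :=
  ⟨fun h => by simpa using Setting.pE_add h Setting.one_mem_pE,
    fun h => Setting.pE_sub h Setting.one_mem_pE⟩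

lemma sub_one_mem_O {z : S.E} : z - 1 ∈ S.O ↔ z ∈ S.O := by
  simp only [← Setting.mem_pE_zero, sub_one_mem_pE_zero]

lemma exists_level (C : Chamber S) : ∃ δ, C.Level δ := by
  have hmono : ∀ z : S.E, z ∈ S.pE 1 → z ∈ S.O := fun z hz =>
    S.mem_pE_zero.1 (Setting.pE_mono (by norm_num) hz)
  have hsub : ∀ z : S.E, z - 1 ∈ S.pE 1 → z ∈ S.O := fun z hz =>
    S.mem_pE_zero.1 (sub_one_mem_pE_zero.1 (Setting.pE_mono (by norm_num) hz))
  have hmono2 : ∀ z : S.E, z ∈ S.pE 2 → z ∈ S.pE 1 := fun z hz =>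
    Setting.pE_mono (by norm_num) hz
  have hmono3 : ∀ z : S.E, z ∈ S.O → z ∈ S.pE (-1) := fun z hz =>
    Setting.pE_mono (by norm_num) (S.mem_pE_zero.2 hz)
  rcases C.cases with ⟨h1, h2, h3, h4, h5, h6, h7, h8, h9⟩ | ⟨h1, h2, h3, h4, h5, h6, h7, h8, h9⟩
  · refine ⟨0, Or.inl rfl, by simpa using h7, by simp [h9], fun g => ?_, fun g => ?_, fun g => ?_,
      ?_⟩
    · rw [← SetLike.mem_coe, h1]
      simp [Setting.K0set, Setting.Shape, Setting.eK, Fin.forall_fin_succ, Setting.mem_pE_zero,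
        sub_one_mem_O, and_assoc]
    · rw [h4]
      simp [Setting.I1K0, Setting.IK0, Setting.K0set, Setting.Shape, Setting.eI,
        Fin.forall_fin_succ, Setting.mem_pE_zero]
      grind
    · rw [h2]
      simp [Setting.Kone0, Setting.Shape, Setting.eP, Fin.forall_fin_succ]
    · rw [h6]
      change S.betaM = _
      simp [Setting.betaM, Setting.sM]
  · refine ⟨1, Or.inr rfl, by simpa using h7, by simp [h9], fun g => ?_, fun g => ?_, fun g => ?_,
      ?_⟩
    · rw [← SetLike.mem_coe, h1]
      simp [Setting.K1set, Setting.Shape, Setting.eK, Fin.forall_fin_succ, Setting.mem_pE_zero,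
        sub_one_mem_O, and_assoc]
    · rw [h4]
      simp [Setting.I1K1, Setting.IK1, Setting.K1set, Setting.Shape, Setting.eI,
        Fin.forall_fin_succ, Setting.mem_pE_zero]
      grind
    · rw [h2]
      simp [Setting.Kone1, Setting.K1set, Setting.Shape, Setting.eP, Fin.forall_fin_succ,
        Setting.mem_pE_zero]
      grind
    · rw [h6]
      change S.betaM * S.alphaMinv = _
      ext i j
      fin_cases i <;> fin_cases j <;>
        simp [Setting.betaM, Setting.alphaMinv, Setting.sM, Matrix.mul_apply, Fin.sum_univ_three]

end Chamber

namespace Setting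

variable {S : Setting}

lemma mem_Nk_iff {k : ℤ} {g : S.GG} :
    g ∈ S.Nk k ↔ ∃ x y h, y ∈ S.pE k ∧ g = S.nE x y h :=
  ⟨fun ⟨x, y, h, hy, e⟩ => ⟨x, y, h, hy, S.mat_inj e⟩,
    fun ⟨x, y, h, hy, e⟩ => ⟨x, y, h, hy, e ▸ rfl⟩⟩

lemma norm_mem_pE {k : ℤ} {x y : S.E} (h : x * S.conj x + y + S.conj y = 0)
    (hy : y ∈ S.pE k) : x * S.conj x ∈ S.pE k := by
  rw [show x * S.conj x = -(y + S.conj y) by linear_combination h]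
  exact pE_neg (pE_add hy (pE_conj hy))

lemma nE_mul {x y x' y' : S.E} (h : x * S.conj x + y + S.conj y = 0)
    (h' : x' * S.conj x' + y' + S.conj y' = 0) :
    ∃ h'', S.nE x y h * S.nE x' y' h' = S.nE (x + x') (y + y' - x * S.conj x') h'' := by
  have h'' : (x + x') * S.conj (x + x') + (y + y' - x * S.conj x') +
      S.conj (y + y' - x * S.conj x') = 0 := by
    simp only [map_add, map_sub, map_mul, S.conj_invol]
    linear_combination h + h'
  refine ⟨h'', S.mat_inj ?_⟩
  rw [mat_mul]
  ext i j
  fin_cases i <;> fin_cases j <;>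
    simp [nM, Matrix.mul_apply, Fin.sum_univ_three] <;> ring

lemma nE_inv {x y : S.E} (h : x * S.conj x + y + S.conj y = 0) :
    ∃ h', (S.nE x y h)⁻¹ = S.nE (-x) (S.conj y) h' := by
  have h' : -x * S.conj (-x) + S.conj y + S.conj (S.conj y) = 0 := by
    simp only [map_neg, S.conj_invol]
    linear_combination h
  refine ⟨h', S.mat_inj ?_⟩
  ext i j
  rw [mat_inv_apply]
  fin_cases i <;> fin_cases j <;> simp [nM, Fin.rev, S.conj_invol]

variable (S) in
/-- The filtration subgroups of the unipotent radical. -/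
def NkSub (k : ℤ) : Subgroup S.GG where
  carrier := S.Nk k
  one_mem' := ⟨0, 0, by simp, pE_zero k, by
    rw [mat_one]
    ext i j
    fin_cases i <;> fin_cases j <;> simp [nM]⟩
  mul_mem' := by
    intro a b ha hb
    obtain ⟨x, y, h, hy, rfl⟩ := mem_Nk_iff.1 ha
    obtain ⟨x', y', h', hy', rfl⟩ := mem_Nk_iff.1 hb
    obtain ⟨h'', e⟩ := nE_mul h h'
    exact mem_Nk_iff.2 ⟨_, _, h'', pE_sub (pE_add hy hy')
      (mem_pE_cross (norm_mem_pE h hy) (norm_mem_pE h' hy')), e⟩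
  inv_mem' := by
    intro a ha
    obtain ⟨x, y, h, hy, rfl⟩ := mem_Nk_iff.1 ha
    obtain ⟨h', e⟩ := nE_inv h
    exact mem_Nk_iff.2 ⟨_, _, h', pE_conj hy, e⟩

lemma nE_mem_Nk_iff {k : ℤ} {x y : S.E} (h : x * S.conj x + y + S.conj y = 0) :
    S.nE x y h ∈ S.Nk k ↔ y ∈ S.pE k := by
  constructor
  · rintro ⟨x', y', -, hy', e⟩
    have := congrFun (congrFun e 0) 2
    simp [nM] at this
    rwa [this]
  · exact fun hy => mem_Nk_iff.2 ⟨x, y, h, hy, rfl⟩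

variable (S) in
/-- The integral points of the diagonal torus. -/
def torus : Set S.GG :=
  {g | ∃ a b ha hb, a ∈ S.pE 0 ∧ a⁻¹ ∈ S.pE 0 ∧ g = S.dE a b ha hb}

lemma mem_pE_of_norm_one {b : S.E} (hb : b * S.conj b = 1) : b ∈ S.pE 0 :=
  mem_pE_of_norm (k := 0) (by norm_num) (hb ▸ one_mem_pE)

lemma torus_inv {g : S.GG} (hg : g ∈ S.torus) : g⁻¹ ∈ S.torus := by
  obtain ⟨a, b, ha, hb, h1, h2, rfl⟩ := hg
  refine ⟨a⁻¹, S.conj b, inv_ne_zero ha, by rw [S.conj_invol, mul_comm, hb], h2, by simpa, ?_⟩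
  apply S.mat_inj
  ext i j
  rw [mat_inv_apply]
  fin_cases i <;> fin_cases j <;> simp [Fin.rev, S.conj_invol]

lemma torus_comm {g g' : S.GG} (hg : g ∈ S.torus) (hg' : g' ∈ S.torus) :
    g * g' = g' * g := by
  obtain ⟨a, b, ha, hb, h1, h2, rfl⟩ := hg
  obtain ⟨a', b', ha', hb', h1', h2', rfl⟩ := hg'
  apply S.mat_inj
  rw [mat_mul, mat_mul]
  ext i j
  fin_cases i <;> fin_cases j <;> simp [Matrix.mul_apply, Fin.sum_univ_three, mul_comm]

/-- Conjugation of the unipotent radical by the torus. -/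
lemma torus_conj_Nk {k : ℤ} {h n : S.GG} (hh : h ∈ S.torus) (hn : n ∈ S.Nk k) :
    h * n * h⁻¹ ∈ S.Nk k := by
  obtain ⟨a, b, ha, hb, h1, h2, rfl⟩ := hh
  obtain ⟨x, y, hxy, hy, rfl⟩ := mem_Nk_iff.1 hn
  have hca : S.conj a ≠ 0 := by simpa using ha
  refine ⟨a * x * S.conj b, a * y * S.conj a, ?_, ?_, ?_⟩
  · simp only [map_mul, S.conj_invol]
    linear_combination (a * x * S.conj a * S.conj x) * hb + a * S.conj a * hxy
  · exact pE_mul (pE_mul (m := k) h1 hy (by omega)) (pE_conj h1) (by omega)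
  · ext i j
    simp only [mat_mul_apply, mat_inv_apply]
    fin_cases i <;> fin_cases j <;>
      simp [nM, Fin.rev, S.conj_invol, ha, hca, hb]
    ring

end Setting

namespace Chamber.Level

open Setting

variable {S : Setting} {C : Chamber S} {δ : ℤ}

lemma mem_K_iff (hL : C.Level δ) {g : S.GG} :
    g ∈ C.K ↔ ∀ i j, S.mat g i j ∈ S.pE (eK δ i j) := by
  rw [hL.mem_K]
  refine forall₂_congr fun i j => ?_
  fin_cases i <;> fin_cases j <;> simp [eK, sub_one_mem_pE_zero]

lemma K_apply (hL : C.Level δ) {g : S.GG} (hg : g ∈ C.K) (i j : Fin 3) :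
    S.mat g i j ∈ S.pE (eK δ i j) := hL.mem_K_iff.1 hg i j

lemma x_mem (hL : C.Level δ) {x y : S.E} (h : x * S.conj x + y + S.conj y = 0)
    (hy : y ∈ S.pE (-δ)) : x ∈ S.pE 0 :=
  mem_pE_of_norm (k := -δ) (by rcases hL.zero_or_one with rfl | rfl <;> norm_num)
    (norm_mem_pE h hy)

lemma x_mem' (hL : C.Level δ) {x y : S.E} (h : x * S.conj x + y + S.conj y = 0)
    (hy : y ∈ S.pE (1 - δ)) : x ∈ S.pE (1 - δ) :=
  mem_pE_of_norm (k := 1 - δ) (by rcases hL.zero_or_one with rfl | rfl <;> norm_num)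
    (norm_mem_pE h hy)

lemma Nk_mem_I1 (hL : C.Level δ) {n : S.GG} (hn : n ∈ S.Nk (-δ)) : n ∈ C.I1 := by
  obtain ⟨x, y, h, hy, rfl⟩ := mem_Nk_iff.1 hn
  have hx := hL.x_mem h hy
  rw [hL.mem_I1]
  intro i j
  fin_cases i <;> fin_cases j <;> simp [nM, eI, pE_zero, hx, hy, pE_neg, pE_conj]

lemma Nk_mem_Kone (hL : C.Level δ) {n : S.GG} (hn : n ∈ S.Nk (1 - δ)) : n ∈ C.KoneS := by
  obtain ⟨x, y, h, hy, rfl⟩ := mem_Nk_iff.1 hn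
  have hx := hL.x_mem' h hy
  rw [hL.mem_Kone]
  intro i j
  fin_cases i <;> fin_cases j <;> simp [nM, eP, pE_zero, hx, hy, pE_neg, pE_conj]

lemma I1_mem_K (hL : C.Level δ) {g : S.GG} (hg : g ∈ C.I1) : g ∈ C.K := by
  rw [hL.mem_I1] at hg
  rw [hL.mem_K]
  intro i j
  refine pE_mono ?_ (hg i j)
  rcases hL.zero_or_one with rfl | rfl <;> fin_cases i <;> fin_cases j <;> simp [eI, eK]

lemma Kone_mem_I1 (hL : C.Level δ) {g : S.GG} (hg : g ∈ C.KoneS) : g ∈ C.I1 := by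
  rw [hL.mem_Kone] at hg
  rw [hL.mem_I1]
  intro i j
  refine pE_mono ?_ (hg i j)
  rcases hL.zero_or_one with rfl | rfl <;> fin_cases i <;> fin_cases j <;> simp [eI, eP]

lemma torus_mem_K (hL : C.Level δ) {g : S.GG} (hg : g ∈ S.torus) : g ∈ C.K := by
  obtain ⟨a, b, ha, hb, h1, h2, rfl⟩ := hg
  rw [hL.mem_K_iff]
  have hb' := mem_pE_of_norm_one hb
  have h3 : (S.conj a)⁻¹ ∈ S.pE 0 := by simpa using pE_conj h2
  intro i j
  fin_cases i <;> fin_cases j <;> simp [eK, pE_zero, h1, hb', h3]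

lemma βK_mem_K (hL : C.Level δ) : C.βK ∈ C.K := by
  rw [hL.mem_K_iff, hL.mat_βK]
  intro i j
  fin_cases i <;> fin_cases j <;> simp [eK, sM, pE_zero, one_mem_pE, zpow_mem_pE,
    -zpow_neg]

lemma mat_βK_mul (hL : C.Level δ) (g : S.GG) (j : Fin 3) :
    S.mat (C.βK * g) 0 j = S.ϖ ^ (-δ) * S.mat g 2 j ∧ S.mat (C.βK * g) 1 j = S.mat g 1 j ∧
      S.mat (C.βK * g) 2 j = S.ϖ ^ δ * S.mat g 0 j := by
  simp only [mat_mul_apply, hL.mat_βK, sM]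
  simp

lemma mat_mul_βK (hL : C.Level δ) (g : S.GG) (i : Fin 3) :
    S.mat (g * C.βK) i 0 = S.ϖ ^ δ * S.mat g i 2 ∧ S.mat (g * C.βK) i 1 = S.mat g i 1 ∧
      S.mat (g * C.βK) i 2 = S.ϖ ^ (-δ) * S.mat g i 0 := by
  simp only [mat_mul_apply, hL.mat_βK, sM]
  simp [mul_comm]

lemma zpow_mul_neg : S.ϖ ^ δ * S.ϖ ^ (-δ) = 1 := by
  rw [← zpow_add₀ S.unif_ne, add_neg_cancel, zpow_zero]

lemma βK_mul_βK (hL : C.Level δ) : C.βK * C.βK = 1 := by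
  apply S.mat_inj
  have e := zpow_mul_neg (S := S) (δ := δ)
  have e' := e
  rw [mul_comm] at e'
  ext i j
  fin_cases i
  · refine (hL.mat_βK_mul _ j).1.trans ?_
    fin_cases j <;> simp only [hL.mat_βK, sM, mat_one] <;> simp [-zpow_neg, e']
  · refine (hL.mat_βK_mul _ j).2.1.trans ?_
    fin_cases j <;> simp only [hL.mat_βK, sM, mat_one] <;> simp
  · refine (hL.mat_βK_mul _ j).2.2.trans ?_
    fin_cases j <;> simp only [hL.mat_βK, sM, mat_one] <;> simp [-zpow_neg, e]

lemma βK_inv (hL : C.Level δ) : C.βK⁻¹ = C.βK :=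
  inv_eq_of_mul_eq_one_left hL.βK_mul_βK

lemma βK_torus (hL : C.Level δ) {h : S.GG} (hh : h ∈ S.torus) :
    C.βK * h * C.βK ∈ S.torus := by
  obtain ⟨a, b, ha, hb, h1, h2, rfl⟩ := hh
  have hca : S.conj a ≠ 0 := by simpa using ha
  refine ⟨(S.conj a)⁻¹, b, inv_ne_zero hca, hb, by simpa using pE_conj h2,
    by simpa using pE_conj h1, ?_⟩
  apply S.mat_inj
  have e := zpow_mul_neg (S := S) (δ := δ)
  have e' := e
  rw [mul_comm] at e'
  ext i j
  fin_cases i <;> fin_cases j <;>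
    simp [mat_mul_apply, hL.mat_βK, sM, -zpow_neg, S.conj_invol, mul_right_comm, e']
  rw [mul_right_comm, e, one_mul]

/-- The opposite unipotent elements attached to `N_{n_K + 1}` lie in the pro-`p` Iwahori
subgroup. -/
lemma βK_Nk_βK (hL : C.Level δ) {n : S.GG} (hn : n ∈ S.Nk (1 - δ)) :
    C.βK * n * C.βK ∈ C.I1 := by
  obtain ⟨x, y, h, hy, rfl⟩ := mem_Nk_iff.1 hn
  have hx := hL.x_mem' h hy
  rw [hL.mem_I1]
  have e := zpow_mul_neg (S := S) (δ := δ)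
  have e' := e
  rw [mul_comm] at e'
  have z := zpow_mem_pE (S := S) δ
  have hc := pE_conj hx
  intro i j
  fin_cases i <;> fin_cases j <;>
    simp [mat_mul_apply, hL.mat_βK, sM, nM, eI, -zpow_neg, pE_zero, e, e']
  · exact pE_neg (pE_mul hc z (by omega))
  · exact pE_mul (pE_mul (m := 1) z hy (by omega)) z (by omega)
  · exact pE_mul z hx (by omega)

/-- The lower left entry distinguishes the Iwahori subgroup. -/
lemma βK_Nk_βK_apply (hL : C.Level δ) {x y : S.E} (h : x * S.conj x + y + S.conj y = 0) :
    S.mat (C.βK * S.nE x y h * C.βK) 2 0 = S.ϖ ^ (2 * δ) * y := by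
  rw [(hL.mat_mul_βK _ 2).1, (hL.mat_βK_mul _ 2).2.2, two_mul, zpow_add₀ S.unif_ne]
  simp [nM, mul_assoc]

end Chamber.Level

namespace Chamber

/-- The Iwahori subgroup inside `K`, cut out by the valuation of the lower left entry. -/
def Iw {S : Setting} (C : Chamber S) (δ : ℤ) : Set S.GG :=
  {g | g ∈ C.K ∧ S.mat g 2 0 ∈ S.pE (1 + δ)}

end Chamber

namespace Chamber.Level

open Setting

variable {S : Setting} {C : Chamber S} {δ : ℤ}

lemma Iw_inv {g : S.GG} (hg : g ∈ C.Iw δ) : g⁻¹ ∈ C.Iw δ :=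
  ⟨C.K.inv_mem hg.1, by rw [mat_inv_apply]; exact pE_conj hg.2⟩

lemma Iw_apply_one_zero (hL : C.Level δ) {g : S.GG} (hg : g ∈ C.Iw δ) :
    S.mat g 1 0 ∈ S.pE 1 := by
  have hK := fun i j => hL.K_apply hg.1 i j
  rcases hL.zero_or_one with rfl | rfl
  · refine mem_pE_of_norm (k := 1) (by norm_num) ?_
    have h := S.column_rel g 0 0
    simp [Fin.rev] at h
    have h00 : S.mat g 0 0 ∈ S.pE 0 := hK 0 0
    rw [show S.mat g 1 0 * S.conj (S.mat g 1 0) =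
      -(S.mat g 0 0 * S.conj (S.mat g 2 0) + S.mat g 2 0 * S.conj (S.mat g 0 0)) by
      linear_combination h]
    exact pE_neg (pE_add (pE_mul h00 (pE_conj hg.2) (by norm_num))
      (pE_mul hg.2 (pE_conj h00) (by norm_num)))
  · exact hK 1 0

lemma Iw_apply_two_one (hL : C.Level δ) {g : S.GG} (hg : g ∈ C.Iw δ) :
    S.mat g 2 1 ∈ S.pE 1 := by
  have := hL.Iw_apply_one_zero (Iw_inv hg)
  rw [mat_inv_apply, pE_conj_iff] at this
  exact this

lemma Iw_mul (hL : C.Level δ) {g g' : S.GG} (hg : g ∈ C.Iw δ) (hg' : g' ∈ C.Iw δ) :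
    g * g' ∈ C.Iw δ := by
  refine ⟨C.K.mul_mem hg.1 hg'.1, ?_⟩
  rw [mat_mul_apply]
  have h00 : S.mat g' 0 0 ∈ S.pE 0 := hL.K_apply hg'.1 0 0
  have h22 : S.mat g 2 2 ∈ S.pE 0 := hL.K_apply hg.1 2 2
  have := hL.zero_or_one
  exact pE_add (pE_add (pE_mul hg.2 h00 (by omega))
    (pE_mul (hL.Iw_apply_two_one hg) (hL.Iw_apply_one_zero hg') (by omega)))
    (pE_mul h22 hg'.2 (by omega))

lemma I1_mem_Iw (hL : C.Level δ) {g : S.GG} (hg : g ∈ C.I1) : g ∈ C.Iw δ := by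
  refine ⟨hL.I1_mem_K hg, ?_⟩
  rw [hL.mem_I1] at hg
  simpa [eI] using hg 2 0

lemma torus_conj_I1 (hL : C.Level δ) {h g : S.GG} (hh : h ∈ S.torus) (hg : g ∈ C.I1) :
    h * g * h⁻¹ ∈ C.I1 := by
  obtain ⟨a, b, ha, hb, h1, h2, rfl⟩ := hh
  have hca : S.conj a ≠ 0 := by simpa using ha
  have hb0 : b ∈ S.pE 0 := mem_pE_of_norm_one hb
  rw [hL.mem_I1] at hg ⊢
  have key : ∀ (d d' : S.E) (k : ℤ) (z : S.E), d ∈ S.pE 0 → d' ∈ S.pE 0 → z ∈ S.pE k →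
      d * z * d' ∈ S.pE k := fun d d' k z hd hd' hz =>
    pE_mul (pE_mul (m := k) hd hz (by omega)) hd' (by omega)
  have hca' : (S.conj a)⁻¹ ∈ S.pE 0 := by simpa using pE_conj h2
  have hdiag : ∀ i, ∃ d d' : S.E, d ∈ S.pE 0 ∧ d' ∈ S.pE 0 ∧ d * d' = 1 ∧
      S.mat (S.dE a b ha hb) i i = d ∧ S.mat (S.dE a b ha hb)⁻¹ i i = d' := by
    intro i
    fin_cases i
    · exact ⟨a, a⁻¹, h1, h2, mul_inv_cancel₀ ha, rfl, by
        simp [mat_inv_apply, Fin.rev, S.conj_invol]⟩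
    · exact ⟨b, S.conj b, hb0, pE_conj hb0, hb, rfl, by simp [mat_inv_apply, Fin.rev]⟩
    · exact ⟨(S.conj a)⁻¹, S.conj a, hca', pE_conj h1, inv_mul_cancel₀ hca, rfl, by
        simp [mat_inv_apply, Fin.rev]⟩
  choose d d' hd hd' hdd e e' using hdiag
  have hoff : ∀ i j, i ≠ j → S.mat (S.dE a b ha hb) i j = 0 ∧
      S.mat (S.dE a b ha hb)⁻¹ i j = 0 := by
    intro i j hij
    fin_cases i <;> fin_cases j <;> simp [mat_inv_apply, Fin.rev] at hij ⊢
  intro i j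
  have hmat : S.mat (S.dE a b ha hb * g * (S.dE a b ha hb)⁻¹) i j = d i * S.mat g i j * d' j := by
    rw [mat_mul, Matrix.mul_apply, Finset.sum_eq_single j
      (fun k _ hk => by rw [(hoff k j hk).2, mul_zero]) (by simp), e', mat_mul, Matrix.mul_apply,
      Finset.sum_eq_single i (fun k _ hk => by rw [(hoff i k hk.symm).1, zero_mul]) (by simp), e]
  have : S.mat (S.dE a b ha hb * g * (S.dE a b ha hb)⁻¹) i j - (1 : S.M3) i j =
      d i * (S.mat g i j - (1 : S.M3) i j) * d' j := by
    rw [hmat]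
    by_cases hij : i = j
    · subst hij
      rw [Matrix.one_apply_eq]
      linear_combination hdd i
    · rw [Matrix.one_apply_ne hij]
      ring
  rw [this]
  exact key _ _ _ _ (hd i) (hd' j) (hg i j)

/-- The Iwahori factorization. -/
lemma exists_Iw_decomp (hL : C.Level δ) {g : S.GG} (hg : g ∈ C.Iw δ) :
    ∃ n ∈ S.Nk (-δ), ∃ h ∈ S.torus, ∃ z ∈ C.KoneS, g = n * h * z := by
  have hK := fun i j => hL.K_apply hg.1 i j
  have h10 := hL.Iw_apply_one_zero hg
  have h21 := hL.Iw_apply_two_one hg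
  have h20 := hg.2
  have h00 : S.mat g 0 0 ∈ S.pE 0 := hK 0 0
  have h01 : S.mat g 0 1 ∈ S.pE 0 := hK 0 1
  have h02 : S.mat g 0 2 ∈ S.pE (-δ) := hK 0 2
  have h12 : S.mat g 1 2 ∈ S.pE 0 := hK 1 2
  have h22 : S.mat g 2 2 ∈ S.pE 0 := hK 2 2
  have hu : S.mat g 2 2 ∉ S.pE 1 := by
    intro hc
    apply one_notMem_pE_one (S := S)
    have h := S.column_rel g 0 2
    simp [Fin.rev] at h
    rw [← h]
    exact pE_add (pE_add (pE_mul h00 (pE_conj hc) (by omega))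
      (pE_mul h10 (pE_conj h12) (by omega))) (pE_mul h20 (pE_conj h02) (by omega))
  set d := S.mat g 2 2 with hd
  have hd0 : d ≠ 0 := ne_zero_of_notMem_pE hu
  have hcd0 : S.conj d ≠ 0 := by simpa using hd0
  have hdi : d⁻¹ ∈ S.pE 0 := by simpa using inv_mem_pE (k := 0) (by simpa using hu)
  set x := -S.conj (S.mat g 1 2 / d) with hx
  set y := S.mat g 0 2 / d with hy
  have hxy : x * S.conj x + y + S.conj y = 0 := by
    have h := S.column_rel g 2 2
    simp [Fin.rev] at h
    simp only [hx, hy, map_neg, S.conj_invol, map_div₀]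
    field_simp
    linear_combination h
  have hym : y ∈ S.pE (-δ) := by
    rw [hy, div_eq_mul_inv]
    exact pE_mul h02 hdi (by omega)
  have hxm := hL.x_mem hxy hym
  obtain ⟨hi, ei⟩ := nE_inv hxy
  have hnK : S.nE x y hxy ∈ C.K := hL.I1_mem_K (hL.Nk_mem_I1 ((nE_mem_Nk_iff hxy).2 hym))
  set w := (S.nE x y hxy)⁻¹ * g with hw
  have hwK : w ∈ C.K := C.K.mul_mem (C.K.inv_mem hnK) hg.1
  have w2 : ∀ j, S.mat w 2 j = S.mat g 2 j := by
    intro j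
    rw [hw, ei, mat_mul_apply]
    simp [nM]
  have w1 : ∀ j, S.mat w 1 j = S.mat g 1 j + S.conj x * S.mat g 2 j := by
    intro j
    rw [hw, ei, mat_mul_apply]
    simp [nM]
  have w12 : S.mat w 1 2 = 0 := by
    rw [w1, hx, map_neg, S.conj_invol, ← hd]
    field_simp
    ring
  have w02 : S.mat w 0 2 = 0 := by
    rw [hw, ei, mat_mul_apply]
    simp only [mat_nE, nM, Matrix.of_apply, Matrix.cons_val', Matrix.cons_val_zero,
      Matrix.cons_val_one, Matrix.cons_val, Matrix.cons_val_fin_one, ← hd]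
    have e1 : S.mat g 0 2 = y * d := by rw [hy]; field_simp
    have e2 : S.mat g 1 2 = -S.conj x * d := by
      rw [hx, map_neg, S.conj_invol]; field_simp
    rw [e1, e2]
    linear_combination d * hxy
  have w22 : S.mat w 2 2 = d := w2 2
  have w01 : S.mat w 0 1 = 0 := by
    have h := S.column_rel w 1 2
    rw [w12, w22, w02] at h
    simpa [Fin.rev, hd0] using h
  have w00 : S.mat w 0 0 * S.conj d = 1 := by
    have h := S.column_rel w 0 2
    rw [w12, w22, w02] at h
    simpa [Fin.rev] using h
  have w11 : S.mat w 1 1 * S.conj (S.mat w 1 1) = 1 := by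
    have h := S.column_rel w 1 1
    rw [w01] at h
    simpa [Fin.rev] using h
  have w10 : S.mat w 1 0 ∈ S.pE 1 := by
    rw [w1]
    refine pE_add h10 (pE_mul (pE_conj hxm) h20 ?_)
    have := hL.zero_or_one
    omega
  have w21 : S.mat w 2 1 ∈ S.pE 1 := by rw [w2]; exact h21
  have w20 : S.mat w 2 0 ∈ S.pE (1 + δ) := by rw [w2]; exact h20
  have ht : S.dE (S.conj d)⁻¹ (S.mat w 1 1) (inv_ne_zero hcd0) w11 ∈ S.torus :=
    ⟨_, _, _, _, by simpa using pE_conj hdi, by simpa using pE_conj h22, rfl⟩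
  set h := S.dE (S.conj d)⁻¹ (S.mat w 1 1) (inv_ne_zero hcd0) w11 with hh
  refine ⟨S.nE x y hxy, (nE_mem_Nk_iff hxy).2 hym, h, ht, h⁻¹ * w, ?_, by rw [hw]; group⟩
  rw [hL.mem_Kone]
  have hb := pE_conj (mem_pE_of_norm_one w11)
  have w00' : S.conj d * S.mat w 0 0 = 1 := by rw [mul_comm, w00]
  have w11' : S.conj (S.mat w 1 1) * S.mat w 1 1 = 1 := by rw [mul_comm, w11]
  intro i j
  fin_cases i <;> fin_cases j <;>
    simp [mat_mul_apply, mat_inv_apply, hh, Fin.rev, S.conj_invol, eP, w00', w01, w02, w12, w11',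
      w22, hd0, pE_zero]
  · exact pE_mul hb w10 (by omega)
  · exact pE_mul hdi w20 (by omega)
  · exact pE_mul hdi w21 (by omega)

/-- The Bruhat decomposition of the nontrivial cell. -/
lemma exists_bruhat (hL : C.Level δ) {g : S.GG} (hg : g ∈ C.K) (hg' : g ∉ C.Iw δ) :
    ∃ n ∈ S.Nk (-δ), ∃ b ∈ C.Iw δ, g = n * C.βK * b := by
  have h20 : S.mat g 2 0 ∉ S.pE (δ + 1) := by
    rw [add_comm]
    exact fun h => hg' ⟨hg, h⟩
  set c := S.mat g 2 0 with hc
  have hc0 : c ≠ 0 := ne_zero_of_notMem_pE h20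
  have hcc0 : S.conj c ≠ 0 := by simpa using hc0
  have hci := inv_mem_pE h20
  have h00 : S.mat g 0 0 ∈ S.pE 0 := hL.K_apply hg 0 0
  set x := -S.conj (S.mat g 1 0 / c) with hx
  set y := S.mat g 0 0 / c with hy
  have hxy : x * S.conj x + y + S.conj y = 0 := by
    have h := S.column_rel g 0 0
    simp [Fin.rev] at h
    simp only [hx, hy, map_neg, S.conj_invol, map_div₀]
    field_simp
    linear_combination h
  have hym : y ∈ S.pE (-δ) := by
    rw [hy, div_eq_mul_inv]
    exact pE_mul h00 hci (by omega)
  have hn : S.nE x y hxy ∈ S.Nk (-δ) := (nE_mem_Nk_iff hxy).2 hym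
  have hnK : S.nE x y hxy ∈ C.K := hL.I1_mem_K (hL.Nk_mem_I1 hn)
  obtain ⟨hi, ei⟩ := nE_inv hxy
  refine ⟨S.nE x y hxy, hn, C.βK * ((S.nE x y hxy)⁻¹ * g), ⟨?_, ?_⟩, ?_⟩
  · exact C.K.mul_mem hL.βK_mem_K (C.K.mul_mem (C.K.inv_mem hnK) hg)
  · rw [(hL.mat_βK_mul _ 0).2.2]
    have : S.mat ((S.nE x y hxy)⁻¹ * g) 0 0 = 0 := by
      rw [ei, mat_mul_apply]
      simp only [mat_nE, nM, Matrix.of_apply, Matrix.cons_val', Matrix.cons_val_zero,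
        Matrix.cons_val_one, Matrix.cons_val, Matrix.cons_val_fin_one, ← hc]
      have e1 : S.mat g 0 0 = y * c := by rw [hy]; field_simp
      have e2 : S.mat g 1 0 = -S.conj x * c := by
        rw [hx, map_neg, S.conj_invol]; field_simp
      rw [e1, e2]
      linear_combination c * hxy
    rw [this, mul_zero]
    exact pE_zero _
  · rw [mul_assoc, ← mul_assoc C.βK C.βK, hL.βK_mul_βK]
    group

lemma βK_notMem_Iw (hL : C.Level δ) : C.βK ∉ C.Iw δ := by
  rintro ⟨-, h⟩
  rw [hL.mat_βK, mem_pE_iff] at h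
  simp only [sM, Matrix.of_apply, Matrix.cons_val', Matrix.cons_val_zero, Matrix.cons_val,
    Matrix.cons_val_fin_one] at h
  rw [← zpow_add₀ S.unif_ne, show δ + -(1 + δ) = -1 by ring, zpow_neg_one] at h
  exact inv_unif_notMem h

lemma βK_Nk_βK_notMem_Iw (hL : C.Level δ) {n : S.GG} (hn : n ∈ S.Nk (-δ))
    (hn' : n ∉ S.Nk (1 - δ)) : C.βK * n * C.βK ∉ C.Iw δ := by
  rintro ⟨-, h⟩
  obtain ⟨x, y, hxy, hy, rfl⟩ := mem_Nk_iff.1 hn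
  rw [hL.βK_Nk_βK_apply hxy] at h
  refine hn' ((nE_mem_Nk_iff hxy).2 ?_)
  have := pE_mul (m := 1 - δ) (zpow_mem_pE (S := S) (-(2 * δ))) h (by omega)
  rwa [← mul_assoc, ← zpow_add₀ S.unif_ne, neg_add_cancel, zpow_zero, one_mul] at this

/-- Elements of `K ∩ α K α⁻¹` lie in the Iwahori subgroup. -/
lemma mem_Iw_of_alpha_conj (hL : C.Level δ) {k k' : S.GG} (hk : k ∈ C.K) (hk' : k' ∈ C.K)
    (h : S.alphaE ^ (-1 : ℤ) * k = k' * S.alphaE ^ (-1 : ℤ)) : k ∈ C.Iw δ := by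
  refine ⟨hk, ?_⟩
  have e := congrArg (fun g => S.mat g 2 0) h
  have h20 : S.mat k' 2 0 ∈ S.pE δ := hL.K_apply hk' 2 0
  have hz := S.unif_ne
  simp only [mat_mul_apply, mat_alphaE_zpow] at e
  simp at e
  have : S.mat k 2 0 = S.ϖ ^ (2 : ℤ) * S.mat k' 2 0 := by
    field_simp at e
    rw [e]
    norm_cast
  rw [this]
  exact pE_mul (zpow_mem_pE 2) h20 (by omega)

lemma torus_conj_Nk_iff {k : ℤ} {h n : S.GG} (hh : h ∈ S.torus) :
    h * n * h⁻¹ ∈ S.Nk k ↔ n ∈ S.Nk k := by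
  refine ⟨fun hn => ?_, torus_conj_Nk hh⟩
  have := torus_conj_Nk (torus_inv hh) hn
  simpa [mul_assoc] using this

lemma Nk_normal (hL : C.Level δ) {n m : S.GG} (hn : n ∈ S.Nk (-δ)) (hm : m ∈ S.Nk (1 - δ)) :
    n * m * n⁻¹ ∈ S.Nk (1 - δ) := by
  obtain ⟨x, y, h, hy, rfl⟩ := mem_Nk_iff.1 hn
  obtain ⟨x', y', h', hy', rfl⟩ := mem_Nk_iff.1 hm
  obtain ⟨hi, ei⟩ := nE_inv h
  obtain ⟨h1, e1⟩ := nE_mul h h'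
  obtain ⟨h2, e2⟩ := nE_mul h1 hi
  rw [ei, e1, e2, nE_mem_Nk_iff]
  have hx := hL.x_mem h hy
  have hx' := hL.x_mem' h' hy'
  have : y + y' - x * S.conj x' + S.conj y - (x + x') * S.conj (-x) =
      y' - x * S.conj x' + x' * S.conj x := by
    rw [map_neg]
    linear_combination h
  rw [this]
  exact pE_add (pE_sub hy' (pE_mul hx (pE_conj hx') (by omega)))
    (pE_mul hx' (pE_conj hx) (by omega))

end Chamber.Level

section FixedLine

variable {𝔽 : Type*} [Field 𝔽] {V : Type*} [AddCommGroup V] [Module 𝔽 V]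

/-- A commuting family of operators stabilising a nonzero finite-dimensional subspace has a
common eigenvector in it. -/
lemma exists_common_eigenvector [IsAlgClosed 𝔽] [FiniteDimensional 𝔽 V] {ι : Type*}
    (f : ι → Module.End 𝔽 V) (hf : ∀ i j, f i * f j = f j * f i) (D : Submodule 𝔽 V)
    (hD : D ≠ ⊥) (hfD : ∀ i, ∀ v ∈ D, f i v ∈ D) :
    ∃ v ∈ D, v ≠ 0 ∧ ∀ i, ∃ c : 𝔽, f i v = c • v := by
  induction hn : Module.finrank 𝔽 D using Nat.strong_induction_on generalizing D with
  | _ n ih =>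
  by_cases hs : ∀ i, ∃ c : 𝔽, ∀ v ∈ D, f i v = c • v
  · obtain ⟨v, hv, hv0⟩ := D.exists_mem_ne_zero_of_ne_bot hD
    exact ⟨v, hv, hv0, fun i => (hs i).imp fun c hc => hc v hv⟩
  · push Not at hs
    obtain ⟨i, hi⟩ := hs
    have : Nontrivial D := Submodule.nontrivial_iff_ne_bot.mpr hD
    obtain ⟨c, hc⟩ := Module.End.exists_eigenvalue ((f i).restrict (hfD i))
    obtain ⟨v, hv⟩ := hc.exists_hasEigenvector
    obtain ⟨u, hu, hui⟩ := hi c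
    have hvi : f i v = c • (v : V) := congrArg Subtype.val hv.apply_eq_smul
    obtain ⟨w, hw, hw0, hwe⟩ := ih (Module.finrank 𝔽 ↥(D ⊓ (f i).eigenspace c))
      (hn ▸ Submodule.finrank_lt_finrank_of_lt (inf_le_left.lt_of_ne fun h =>
        hui (Module.End.mem_eigenspace_iff.mp (h.ge hu).2)))
      (D ⊓ (f i).eigenspace c)
      (fun h => hv.2 (Subtype.ext ((Submodule.eq_bot_iff _).mp h v
        ⟨v.2, Module.End.mem_eigenspace_iff.mpr hvi⟩)))
      (fun j x hx => ⟨hfD j x hx.1, Module.End.mem_eigenspace_iff.mpr (by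
        rw [← Module.End.mul_apply, hf, Module.End.mul_apply,
          Module.End.mem_eigenspace_iff.mp hx.2, map_smul])⟩) rfl
    exact ⟨w, hw.1, hw0, hwe⟩

/-- A `p`-group acting linearly on a nonzero vector space of characteristic `p` has a nonzero
fixed vector. -/
lemma exists_fixed_vector {p : ℕ} [Fact p.Prime] [CharP 𝔽 p] {Q : Type*} [Group Q] [Finite Q]
    (hQ : IsPGroup p Q) (ρ : Q →* Module.End 𝔽 V) [Nontrivial V] :
    ∃ v : V, v ≠ 0 ∧ ∀ q, ρ q v = v := by
  obtain ⟨v, hv⟩ := exists_ne (0 : V)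
  let M := AddSubgroup.closure (Set.range fun q => ρ q v)
  have hpM : ∀ m : M, p • m = 0 := fun m => Subtype.ext (by
    rw [AddSubgroup.coe_nsmul, ← Nat.cast_smul_eq_nsmul 𝔽, CharP.cast_eq_zero, zero_smul]; rfl)
  have : AddGroup.FG M := (AddGroup.fg_iff_addSubgroup_fg _).mpr
    ⟨(Set.finite_range fun q => ρ q v).toFinset, by simp [M]⟩
  have : Finite M := AddCommGroup.finite_of_fg_isAddTorsion M fun m =>
    isOfFinAddOrder_iff_nsmul_eq_zero.mpr ⟨p, (Fact.out : p.Prime).pos, hpM m⟩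
  have hst : ∀ q, ∀ m ∈ M, ρ q m ∈ M := fun q m hm => by
    induction hm using AddSubgroup.closure_induction with
    | mem x hx =>
      obtain ⟨r, rfl⟩ := hx
      exact AddSubgroup.subset_closure ⟨q * r, by simp⟩
    | zero => simp
    | add x y _ _ hx hy => rw [map_add]; exact M.add_mem hx hy
    | neg x _ hx => rw [map_neg]; exact M.neg_mem hx
  let act : MulAction Q M :=
    { smul := fun q m => ⟨ρ q m, hst q m m.2⟩
      one_smul := fun m => Subtype.ext (by change ρ 1 (m : V) = m; simp)
      mul_smul := fun q r m => Subtype.ext (by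
        change ρ (q * r) (m : V) = ρ q (ρ r m); simp) }
  have hvM : v ∈ M := AddSubgroup.subset_closure ⟨1, by simp⟩
  have hdvd : p ∣ Nat.card M := by
    rw [← addOrderOf_eq_prime (hpM ⟨v, hvM⟩) fun h => hv (congrArg Subtype.val h)]
    exact addOrderOf_dvd_natCard _
  obtain ⟨b, hb, hb0⟩ := hQ.exists_fixed_point_of_prime_dvd_card_of_fixed_point M hdvd
    (a := 0) (fun q => Subtype.ext (map_zero (ρ q)))
  exact ⟨b, fun h => hb0 (Subtype.ext h.symm), fun q => congrArg Subtype.val (hb q)⟩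

/-- In an irreducible module over a finite group with a split `BN`-pair of rank one in the
defining characteristic, the vectors fixed by the unipotent radical `Q` form a line. Here `η` is
the action of the torus and `s` that of the nontrivial Weyl element. -/
lemma fixed_eq_smul [IsAlgClosed 𝔽] [FiniteDimensional 𝔽 V]
    {p : ℕ} [Fact p.Prime] [CharP 𝔽 p] {Q : Type*} [Group Q] [Fintype Q]
    (hQ : IsPGroup p Q) (hcard : (Fintype.card Q : 𝔽) = 0) {ι : Type*}
    (ρ : Q →* Module.End 𝔽 V) (η : ι → Module.End 𝔽 V) (s : Module.End 𝔽 V)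
    (hη : ∀ i j, η i * η j = η j * η i) (hss : s * s = 1)
    (hηρ : ∀ i, ∃ e : Equiv.Perm Q, ∀ q, η i * ρ q = ρ (e q) * η i)
    (hsη : ∀ i, ∃ j, s * η i = η j * s)
    (hs : ∀ q ≠ 1, ∃ q₁ q₂ i, s * ρ q * s = ρ q₁ * s * ρ q₂ * η i)
    (hirr : ∀ (φ : Module.Dual 𝔽 V) (w : V), φ ≠ 0 → w ≠ 0 →
      (∃ q i, φ (ρ q (η i w)) ≠ 0) ∨ ∃ q q' i, φ (ρ q (s (ρ q' (η i w)))) ≠ 0)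
    {w₀ : V} (hw₀ : w₀ ≠ 0) (hρw₀ : ∀ q, ρ q w₀ = w₀) {w : V} (hρw : ∀ q, ρ q w = w) :
    ∃ c : 𝔽, w = c • w₀ := by
  have hηinv : ∀ i (x : V), (∀ q, ρ q x = x) → ∀ q, ρ q (η i x) = η i x := fun i x hx q => by
    obtain ⟨e, he⟩ := hηρ i
    have := congrArg (fun f : Module.End 𝔽 V => f x) (he (e.symm q))
    simpa [hx] using this.symm
  have hsη' : ∀ i, ∃ j, ∀ x, s (η i x) = η j (s x) := fun i =>
    (hsη i).imp fun j hj x => congrArg (fun f : Module.End 𝔽 V => f x) hj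
  have hηρ' : ∀ i, ∃ e : Equiv.Perm Q, ∀ q x, η i (ρ q x) = ρ (e q) (η i x) := fun i =>
    (hηρ i).imp fun e he q x => congrArg (fun f : Module.End 𝔽 V => f x) (he q)
  have hs' : ∀ q ≠ 1, ∃ q₁ q₂ i, ∀ x, s (ρ q (s x)) = ρ q₁ (s (ρ q₂ (η i x))) := fun q hq => by
    obtain ⟨q₁, q₂, i, h⟩ := hs q hq
    exact ⟨q₁, q₂, i, fun x => congrArg (fun f : Module.End 𝔽 V => f x) h⟩
  have hss' : ∀ x, s (s x) = x := fun x => congrArg (fun f : Module.End 𝔽 V => f x) hss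
  obtain ⟨φ, hφ0, hφρ, hφη, c, hφT⟩ : ∃ φ : Module.Dual 𝔽 V, φ ≠ 0 ∧ (∀ q x, φ (ρ q x) = φ x) ∧
      (∀ i, ∃ c : 𝔽, ∀ x, φ (η i x) = c * φ x) ∧
      ∃ c : 𝔽, ∀ x, ∑ q, φ (s (ρ q x)) = c * φ x := by
    have : Nontrivial (Module.Dual 𝔽 V) := by
      have : Nontrivial V := ⟨w₀, 0, hw₀⟩
      infer_instance
    let ρd : Q →* Module.End 𝔽 (Module.Dual 𝔽 V) :=
      { toFun := fun q => (ρ q⁻¹).dualMap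
        map_one' := by ext; simp
        map_mul' := fun q r => by ext; simp }
    obtain ⟨ψ, hψ0, hψ⟩ := exists_fixed_vector hQ ρd
    let D : Submodule 𝔽 (Module.Dual 𝔽 V) :=
      { carrier := {φ | ∀ q x, φ (ρ q x) = φ x}
        add_mem' := fun ha hb q x => by simp [ha q x, hb q x]
        zero_mem' := fun q x => by simp
        smul_mem' := fun c φ h q x => by simp [h q x] }
    have hψD : ψ ∈ D := fun q x => by
      conv_rhs => rw [← hψ q⁻¹]
      simp [ρd]
    obtain ⟨φ₀, hD, hφ₀, hη₀⟩ := exists_common_eigenvector (fun i => (η i).dualMap)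
      (fun i j => LinearMap.ext fun φ => LinearMap.ext fun x =>
        congrArg (fun f : Module.End 𝔽 V => φ (f x)) (hη j i)) D
      (fun h => hψ0 ((Submodule.eq_bot_iff _).mp h ψ hψD)) (fun i v hv q x => by
        obtain ⟨e, he⟩ := hηρ' i
        simp only [LinearMap.dualMap_apply, he]
        exact hv _ _)
    have hη₁ : ∀ i, ∃ c : 𝔽, ∀ x, φ₀ (η i x) = c * φ₀ x := fun i =>
      (hη₀ i).imp fun c hc x => by
        simpa using congrArg (fun f : Module.Dual 𝔽 V => f x) hc
    let φ₁ : Module.Dual 𝔽 V := ∑ q, φ₀ ∘ₗ s ∘ₗ ρ q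
    have hφ₁ : ∀ x, φ₁ x = ∑ q, φ₀ (s (ρ q x)) := fun x => by simp [φ₁]
    by_cases h1 : φ₁ = 0
    · exact ⟨φ₀, hφ₀, hD, hη₁, 0, fun x => by rw [← hφ₁, h1]; simp⟩
    have hη₂ : ∀ i, ∃ c : 𝔽, ∀ x, φ₁ (η i x) = c * φ₁ x := fun i => by
      obtain ⟨e, he⟩ := hηρ' i
      obtain ⟨j, hj⟩ := hsη' i
      obtain ⟨c, hc⟩ := hη₁ j
      refine ⟨c, fun x => ?_⟩
      rw [hφ₁, hφ₁, ← Equiv.sum_comp e fun q => φ₀ (s (ρ q (η i x))), Finset.mul_sum]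
      exact Finset.sum_congr rfl fun q _ => by rw [← he, hj, hc]
    refine ⟨φ₁, h1, fun r x => ?_, hη₂, ?_⟩
    · rw [hφ₁, hφ₁, ← Equiv.sum_comp (Equiv.mulRight r) fun q => φ₀ (s (ρ q x))]
      exact Finset.sum_congr rfl fun q _ => by simp
    · have key : ∀ q, ∃ c : 𝔽, ∀ x, ∑ r, φ₀ (s (ρ q (s (ρ r x)))) = c * φ₁ x := fun q => by
        by_cases hq : q = 1
        · refine ⟨0, fun x => ?_⟩
          simp [hq, hss', hD _ x, hcard]
        obtain ⟨q₁, q₂, i, h⟩ := hs' q hq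
        obtain ⟨e, he⟩ := hηρ' i
        obtain ⟨c, hc⟩ := hη₂ i
        refine ⟨c, fun x => ?_⟩
        rw [← hc, hφ₁,
          ← Equiv.sum_comp (e.trans (Equiv.mulLeft q₂)) fun q => φ₀ (s (ρ q (η i x)))]
        exact Finset.sum_congr rfl fun r _ => by rw [h, hD, he]; simp
      choose c hc using key
      refine ⟨∑ q, c q, fun x => ?_⟩
      simp only [hφ₁, Finset.sum_mul]
      rw [Finset.sum_comm]
      exact Finset.sum_congr rfl fun q _ => by rw [hc, hφ₁]
  have key : ∀ x : V, (∀ q, ρ q x = x) → φ (s x) = 0 → x = 0 := fun x hx hsx => by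
    have hη0 : ∀ i, φ (s (η i x)) = 0 := fun i => by
      obtain ⟨j, hj⟩ := hsη' i
      obtain ⟨c, hc⟩ := hφη j
      rw [hj, hc, hsx, mul_zero]
    have hφx : φ x = 0 := by
      by_cases hc0 : c = 0
      · have := hφT (s x)
        rw [hc0, zero_mul, Finset.sum_eq_single 1 _ (by simp)] at this
        · simpa [hss'] using this
        · intro q _ hq
          obtain ⟨q₁, q₂, i, h⟩ := hs' q hq
          rw [h, hφρ, hηinv i x hx, hη0]
      · have := hφT x
        simp only [hx, Finset.sum_const, hsx, smul_zero] at this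
        exact (mul_eq_zero.mp this.symm).resolve_left hc0
    by_contra hx0
    rcases hirr φ x hφ0 hx0 with ⟨q, i, h⟩ | ⟨q, q', i, h⟩
    · obtain ⟨c, hc⟩ := hφη i
      exact h (by rw [hφρ, hc, hφx, mul_zero])
    · exact h (by rw [hφρ, hηinv i x hx, hη0])
  refine ⟨φ (s w) / φ (s w₀), sub_eq_zero.mp (key _ (fun q => ?_) ?_)⟩
  · rw [map_sub, map_smul, hρw, hρw₀]
  · have := fun h => hw₀ (key w₀ hρw₀ h)
    rw [map_sub, map_smul, map_sub, map_smul, smul_eq_mul, div_mul_cancel₀ _ this, sub_self]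

end FixedLine

namespace Chamber.Level

open Setting

variable {S : Setting} {C : Chamber S} {δ : ℤ}

/-- The group `N_{n_K} / N_{n_K + 1}`. -/
abbrev quot (S : Setting) (δ : ℤ) : Type :=
  S.NkSub (-δ) ⧸ (S.NkSub (1 - δ)).subgroupOf (S.NkSub (-δ))

lemma quot_normal (hL : C.Level δ) : ((S.NkSub (1 - δ)).subgroupOf (S.NkSub (-δ))).Normal :=
  ⟨fun _ hm n => hL.Nk_normal n.2 hm⟩

variable {𝔽 : Type} [Field 𝔽] {W : Type} [AddCommGroup W] [Module 𝔽 W]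
  {σ : Representation 𝔽 ↥C.K W}

lemma sigma'_apply {g : S.GG} (hg : g ∈ C.K) : sigma' C 𝔽 W σ g = σ ⟨g, hg⟩ := dif_pos hg

lemma sigma'_mul {g h : S.GG} (hg : g ∈ C.K) (hh : h ∈ C.K) :
    sigma' C 𝔽 W σ (g * h) = sigma' C 𝔽 W σ g * sigma' C 𝔽 W σ h := by
  rw [sigma'_apply hg, sigma'_apply hh, sigma'_apply (C.K.mul_mem hg hh), ← map_mul]
  rfl

lemma sigma'_one : sigma' C 𝔽 W σ 1 = 1 := by
  rw [sigma'_apply C.K.one_mem]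
  exact map_one σ

lemma sigma'_Kone (hL : C.Level δ) (hσ : IsWeight C 𝔽 W σ) {g : S.GG} (hg : g ∈ C.KoneS) :
    sigma' C 𝔽 W σ g = 1 := by
  have hK := hL.I1_mem_K (hL.Kone_mem_I1 hg)
  rw [sigma'_apply hK, hσ.2.2.2 g hK hg]
  rfl

lemma Nk_mem_K (hL : C.Level δ) {n : S.GG} (hn : n ∈ S.Nk (-δ)) : n ∈ C.K :=
  hL.I1_mem_K (hL.Nk_mem_I1 hn)

/-- The torus acts by scalars on a nonzero vector of a weight fixed by the pro-`p` Iwahori. -/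
lemma torus_smul (hL : C.Level δ) [IsAlgClosed 𝔽] [CharP 𝔽 S.p] (hσ : IsWeight C 𝔽 W σ)
    {m : ℕ} (hm : m ≠ 0) (hQ : Nat.card (quot S δ) = S.p ^ m) {v : W} (hv : v ≠ 0)
    (hI : ∀ g ∈ C.I1, sigma' C 𝔽 W σ g v = v) {h : S.GG} (hh : h ∈ S.torus) :
    ∃ c : 𝔽, sigma' C 𝔽 W σ h v = c • v := by
  have := hL.quot_normal
  have hp : Fact S.p.Prime := ⟨S.hp⟩
  have : FiniteDimensional 𝔽 W := hσ.2.1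
  have : Finite (quot S δ) := Nat.finite_of_card_ne_zero (hQ ▸ pow_ne_zero _ S.hp.ne_zero)
  have := Fintype.ofFinite (quot S δ)
  let τ := sigma' C 𝔽 W σ
  have hle : S.NkSub (-δ) ≤ C.K := fun _ hn => hL.Nk_mem_K hn
  let ρ : quot S δ →* Module.End 𝔽 W := QuotientGroup.lift _
    (σ.comp (Subgroup.inclusion hle)) fun n hn => hσ.2.2.2 _ (hle n.2) (hL.Nk_mem_Kone hn)
  have hρmk : ∀ (n : S.GG) (hn : n ∈ S.Nk (-δ)),
      ρ (QuotientGroup.mk (⟨n, hn⟩ : S.NkSub (-δ))) = τ n := fun n hn =>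
    (sigma'_apply (hle hn)).symm
  have hrep : ∀ q : quot S δ, ∃ n, ∃ hn : n ∈ S.Nk (-δ),
      QuotientGroup.mk (⟨n, hn⟩ : S.NkSub (-δ)) = q := fun q => by
    obtain ⟨n, rfl⟩ := QuotientGroup.mk_surjective q
    exact ⟨n, n.2, rfl⟩
  choose r hr hrq using hrep
  have hρr : ∀ q, ρ q = τ (r q) := fun q => by rw [← hρmk _ (hr q), hrq]
  have hTK : ∀ t : S.torus, (t : S.GG) ∈ C.K := fun t => hL.torus_mem_K t.2
  have hIw : ∀ b ∈ C.Iw δ, ∃ q, ∃ t : S.torus, τ b = ρ q * τ t := fun b hb => by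
    obtain ⟨n, hn, t, ht, z, hz, rfl⟩ := hL.exists_Iw_decomp hb
    refine ⟨QuotientGroup.mk ⟨n, hn⟩, ⟨t, ht⟩, ?_⟩
    rw [hρmk, ← mul_one (τ n * _), ← hL.sigma'_Kone hσ hz]
    simp only [τ]
    rw [sigma'_mul (C.K.mul_mem (hle hn) (hL.torus_mem_K ht))
      (hL.I1_mem_K (hL.Kone_mem_I1 hz)), sigma'_mul (hle hn) (hL.torus_mem_K ht)]
  have hcell : ∀ g ∈ C.K, g ∉ C.Iw δ → ∃ q₁ q₂, ∃ t : S.torus,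
      τ g = ρ q₁ * τ C.βK * ρ q₂ * τ t := fun g hg hg' => by
    obtain ⟨n, hn, b, hb, rfl⟩ := hL.exists_bruhat hg hg'
    obtain ⟨q, t, e⟩ := hIw b hb
    refine ⟨QuotientGroup.mk ⟨n, hn⟩, q, t, ?_⟩
    rw [mul_assoc (_ * _), ← e, hρmk]
    simp only [τ]
    rw [sigma'_mul (C.K.mul_mem (hle hn) hL.βK_mem_K) hb.1, sigma'_mul (hle hn) hL.βK_mem_K]
  have hfix : ∀ q, ρ q v = v := fun q => by
    rw [hρr]
    exact hI _ (hL.Nk_mem_I1 (hr q))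
  have hcomm : ∀ t : S.torus, ∃ e : Equiv.Perm (quot S δ),
      ∀ q, τ t * ρ q = ρ (e q) * τ t := fun t => by
    let e : quot S δ → quot S δ := fun q =>
      QuotientGroup.mk (⟨t * r q * (t : S.GG)⁻¹, torus_conj_Nk t.2 (hr q)⟩ : S.NkSub (-δ))
    have he : Function.Injective e := fun q q' h => by
      have h1 := QuotientGroup.eq.mp h
      have h2 : (t : S.GG) * ((r q)⁻¹ * r q') * (t : S.GG)⁻¹ ∈ S.Nk (1 - δ) := by
        have : (t * r q * (t : S.GG)⁻¹)⁻¹ * (t * r q' * (t : S.GG)⁻¹) ∈ S.Nk (1 - δ) := h1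
        convert this using 1
        group
      rw [← hrq q, ← hrq q']
      exact QuotientGroup.eq.mpr ((torus_conj_Nk_iff t.2).mp h2)
    refine ⟨Equiv.ofBijective e (Finite.injective_iff_bijective.mp he), fun q => ?_⟩
    have e1 : ρ (e q) = τ (t * r q * (t : S.GG)⁻¹) := hρmk _ _
    rw [Equiv.ofBijective_apply, e1, hρr]
    simp only [τ]
    rw [← sigma'_mul (hTK t) (hle (hr q)),
      ← sigma'_mul (C.K.mul_mem (C.K.mul_mem (hTK t) (hle (hr q))) (C.K.inv_mem (hTK t))) (hTK t),
      inv_mul_cancel_right]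
  refine fixed_eq_smul (p := S.p) (IsPGroup.of_card hQ) ?_ ρ (fun t : S.torus => τ t) (τ C.βK)
    ?_ ?_ hcomm ?_ ?_ ?_ hv hfix ?_
  · rw [← Nat.card_eq_fintype_card, hQ, Nat.cast_pow, CharP.cast_eq_zero, zero_pow hm]
  · intro t t'
    simp only [τ]
    rw [← sigma'_mul (hTK t) (hTK t'), ← sigma'_mul (hTK t') (hTK t), torus_comm t.2 t'.2]
  · simp only [τ]
    rw [← sigma'_mul hL.βK_mem_K hL.βK_mem_K, hL.βK_mul_βK, sigma'_one]
  · intro t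
    refine ⟨⟨_, hL.βK_torus t.2⟩, ?_⟩
    simp only [τ]
    rw [← sigma'_mul hL.βK_mem_K (hTK t),
      ← sigma'_mul (hL.torus_mem_K (hL.βK_torus t.2)) hL.βK_mem_K, mul_assoc _ C.βK C.βK,
      hL.βK_mul_βK, mul_one]
  · intro q hq
    rw [hρr]
    simp only [τ]
    rw [← sigma'_mul hL.βK_mem_K (hle (hr q)),
      ← sigma'_mul (C.K.mul_mem hL.βK_mem_K (hle (hr q))) hL.βK_mem_K]
    refine hcell _ (C.K.mul_mem (C.K.mul_mem hL.βK_mem_K (hle (hr q))) hL.βK_mem_K)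
      (hL.βK_Nk_βK_notMem_Iw (hr q) fun h => hq ?_)
    rw [← hrq q]
    exact (QuotientGroup.eq_one_iff _).mpr h
  · intro φ w hφ hw
    obtain ⟨k, hk⟩ : ∃ k, φ (σ k w) ≠ 0 := by
      by_contra! h0
      rcases hσ.2.2.1 (Submodule.span 𝔽 (Set.range fun k => σ k w)) (fun k x hx => by
        refine Submodule.span_induction (p := fun x _ => σ k x ∈ _) ?_ ?_ ?_ ?_ hx
        · rintro _ ⟨k', rfl⟩
          exact Submodule.subset_span ⟨k * k', by simp⟩
        · simp
        · intro x y _ _ hx hy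
          rw [map_add]
          exact add_mem hx hy
        · intro c x _ hx
          rw [map_smul]
          exact Submodule.smul_mem _ _ hx) with h | h
      · exact hw ((Submodule.eq_bot_iff _).mp h w (Submodule.subset_span ⟨1, by simp⟩))
      · refine hφ (LinearMap.ext fun x => ?_)
        refine Submodule.span_induction (p := fun x _ => φ x = 0) ?_ ?_ ?_ ?_
          (h.ge (Submodule.mem_top (x := x)))
        · rintro _ ⟨k', rfl⟩
          exact h0 k'
        · simp
        · intro x y _ _ hx hy
          rw [map_add, hx, hy, add_zero]
        · intro c x _ hx
          rw [map_smul, hx, smul_zero]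
    have hτk : σ k = τ k := (sigma'_apply k.2).symm
    rw [hτk] at hk
    by_cases hkI : (k : S.GG) ∈ C.Iw δ
    · obtain ⟨q, t, e⟩ := hIw _ hkI
      exact Or.inl ⟨q, t, by simpa [e] using hk⟩
    · obtain ⟨q₁, q₂, t, e⟩ := hcell _ k.2 hkI
      exact Or.inr ⟨q₁, q₂, t, by simpa [e] using hk⟩
  · intro q
    obtain ⟨e, he⟩ := hcomm ⟨h, hh⟩
    have := congrArg (fun f : Module.End 𝔽 W => f v) (he (e.symm q))
    simpa [hfix] using this.symm

end Chamber.Level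

namespace Setting

variable {S : Setting}

lemma alphaE_zpow_mul_torus (k : ℤ) {h : S.GG} (hh : h ∈ S.torus) :
    S.alphaE ^ k * h = h * S.alphaE ^ k := by
  obtain ⟨a, b, ha, hb, -, -, rfl⟩ := hh
  refine S.mat_inj ?_
  ext i j
  simp only [mat_mul_apply, mat_alphaE_zpow, mat_dE]
  fin_cases i <;> fin_cases j <;> simp [mul_comm]

end Setting

namespace Chamber.Level

open Setting

variable {S : Setting} {C : Chamber S} {δ : ℤ}
  {𝔽 : Type} [Field 𝔽] {W : Type} [AddCommGroup W] [Module 𝔽 W]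
  {σ : Representation 𝔽 ↥C.K W} {v0 : W} {ff : ℤ → ↥(IndSub C 𝔽 W σ)}

lemma indRep_apply (g x : S.GG) (f : IndSub C 𝔽 W σ) :
    (indRep C 𝔽 W σ g f : S.GG → W) x = (f : S.GG → W) (x * g) := rfl

lemma ff_mul_I1 (hff : IsFFamily C 𝔽 W σ v0 ff) (n : ℤ) (x : S.GG) {i : S.GG} (hi : i ∈ C.I1) :
    (ff n : S.GG → W) (x * i) = (ff n : S.GG → W) x := by
  rw [← indRep_apply, hff.2.2.1 n i hi]

lemma indSub_mul (f : IndSub C 𝔽 W σ) {k : S.GG} (hk : k ∈ C.K) (x : S.GG) :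
    (f : S.GG → W) (k * x) = sigma' C 𝔽 W σ k ((f : S.GG → W) x) := by
  rw [sigma'_apply hk]
  exact f.2.1 k hk x

/-- An eigenvector `v₀` of the torus yields torus eigenvectors `f_n`. -/
lemma torus_smul_ff (hL : C.Level δ) (hff : IsFFamily C 𝔽 W σ v0 ff)
    (hv : ∀ h ∈ S.torus, ∃ c : 𝔽, sigma' C 𝔽 W σ h v0 = c • v0) {h : S.GG} (hh : h ∈ S.torus) :
    ∃ c : 𝔽, indRep C 𝔽 W σ h (ff 1) = c • ff 1 := by
  have hβ := hL.βK_mem_K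
  have hhK := hL.torus_mem_K hh
  obtain ⟨c, hc⟩ := hv _ (hL.βK_torus hh)
  refine ⟨c, Subtype.ext (funext fun x => ?_)⟩
  change (ff 1 : S.GG → W) (x * h) = c • (ff 1 : S.GG → W) x
  by_cases hx : ∃ k ∈ C.K, ∃ i ∈ C.I1, x = k * S.alphaE ^ (-1 : ℤ) * i
  · obtain ⟨k, hk, i, hi, rfl⟩ := hx
    have e : k * S.alphaE ^ (-1 : ℤ) * i * h =
        k * (h * S.alphaE ^ (-1 : ℤ)) * (h⁻¹ * i * h⁻¹⁻¹) := by
      rw [← alphaE_zpow_mul_torus _ hh]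
      group
    have e' : h * C.βK = C.βK * (C.βK * h * C.βK) := by
      rw [← mul_assoc, ← mul_assoc, hL.βK_mul_βK, one_mul]
    rw [e, ff_mul_I1 hff _ _ (hL.torus_conj_I1 (torus_inv hh) hi), ff_mul_I1 hff _ _ hi,
      indSub_mul _ hk, indSub_mul _ hk, indSub_mul _ hhK, hff.2.2.2.2.1 1 one_pos,
      ← Module.End.mul_apply (sigma' C 𝔽 W σ h), ← sigma'_mul hhK hβ, e',
      sigma'_mul hβ (hL.torus_mem_K (hL.βK_torus hh)), Module.End.mul_apply, hc,
      map_smul, map_smul]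
  · have h1 : (ff 1 : S.GG → W) x = 0 := not_not.mp fun h0 => hx (hff.2.2.2.1 1 x h0)
    rw [h1, smul_zero]
    by_contra h0
    obtain ⟨k, hk, i, hi, e⟩ := hff.2.2.2.1 1 _ h0
    refine hx ⟨k * h⁻¹, C.K.mul_mem hk (C.K.inv_mem hhK), h * i * h⁻¹,
      hL.torus_conj_I1 hh hi, ?_⟩
    rw [← mul_inv_cancel_right x h, e, mul_assoc k h⁻¹, ← alphaE_zpow_mul_torus _ (torus_inv hh)]
    group

lemma Iw_smul_ff (hL : C.Level δ) (hff : IsFFamily C 𝔽 W σ v0 ff)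
    (hv : ∀ h ∈ S.torus, ∃ c : 𝔽, sigma' C 𝔽 W σ h v0 = c • v0) {b : S.GG} (hb : b ∈ C.Iw δ) :
    ∃ c : 𝔽, indRep C 𝔽 W σ b (ff 1) = c • ff 1 := by
  obtain ⟨n, hn, h, hh, z, hz, rfl⟩ := hL.exists_Iw_decomp hb
  obtain ⟨c, hc⟩ := hL.torus_smul_ff hff hv hh
  refine ⟨c, ?_⟩
  rw [map_mul, map_mul, Module.End.mul_apply, Module.End.mul_apply,
    hff.2.2.1 1 z (hL.Kone_mem_I1 hz), hc, map_smul, hff.2.2.1 1 n (hL.Nk_mem_I1 hn)]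

lemma ff_one_alphaE_mul (hL : C.Level δ) (hff : IsFFamily C 𝔽 W σ v0 ff) {k : S.GG}
    (hk : k ∈ C.K) (hkI : k ∉ C.Iw δ) :
    (ff 1 : S.GG → W) (S.alphaE ^ (-1 : ℤ) * k) = 0 := by
  by_contra h0
  obtain ⟨k', hk', i, hi, e⟩ := hff.2.2.2.1 1 _ h0
  refine hkI ?_
  rw [← inv_mul_cancel_right k i]
  refine hL.Iw_mul (hL.mem_Iw_of_alpha_conj (C.K.mul_mem hk (C.K.inv_mem (hL.I1_mem_K hi))) hk' ?_)
    (hL.I1_mem_Iw hi)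
  rw [← mul_assoc, e, mul_inv_cancel_right]

lemma ff_one_alphaE_ne_zero (hL : C.Level δ) (hff : IsFFamily C 𝔽 W σ v0 ff) :
    (ff 1 : S.GG → W) (S.alphaE ^ (-1 : ℤ)) ≠ 0 := fun h => hff.1 (by
  rw [hff.2.2.2.2.1 1 one_pos] at h
  have := congrArg (sigma' C 𝔽 W σ C.βK) h
  rwa [map_zero, ← Module.End.mul_apply, ← sigma'_mul hL.βK_mem_K hL.βK_mem_K, hL.βK_mul_βK,
    sigma'_one] at this)

/-- Translates of `f₁` by elements of `K` in distinct cosets of the Iwahori subgroup are linearly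
independent. -/
lemma linearIndependent_translates (hL : C.Level δ) (hff : IsFFamily C 𝔽 W σ v0 ff)
    {ι : Type*} [Fintype ι] (k : ι → S.GG) (hk : ∀ i, k i ∈ C.K)
    (hkI : ∀ i j, i ≠ j → (k j)⁻¹ * k i ∉ C.Iw δ) :
    LinearIndependent 𝔽 fun i => indRep C 𝔽 W σ (k i) (ff 1) := by
  rw [Fintype.linearIndependent_iff]
  intro c hc j
  have h := congrArg (fun f : IndSub C 𝔽 W σ => (f : S.GG → W) (S.alphaE ^ (-1 : ℤ) * (k j)⁻¹)) hc
  simp only [Submodule.coe_sum, Submodule.coe_smul, Finset.sum_apply, Pi.smul_apply, indRep_apply,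
    mul_assoc] at h
  rw [Finset.sum_eq_single j (fun i _ hij => by
    rw [hL.ff_one_alphaE_mul hff (C.K.mul_mem (C.K.inv_mem (hk j)) (hk i)) (hkI i j hij),
      smul_zero]) (by simp), inv_mul_cancel, mul_one] at h
  exact (smul_eq_zero.mp h).resolve_right (hL.ff_one_alphaE_ne_zero hff)

lemma mul_βK_notMem_Iw (hL : C.Level δ) {n : S.GG} (hn : n ∈ S.Nk (-δ)) :
    n * C.βK ∉ C.Iw δ := fun h => hL.βK_notMem_Iw (by
  rw [← inv_mul_cancel_left n C.βK]
  exact hL.Iw_mul (Iw_inv (hL.I1_mem_Iw (hL.Nk_mem_I1 hn))) h)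

/-- Representatives of `K` modulo the Iwahori subgroup. -/
def cell (C : Chamber S) {Uf : Finset S.GG} (z : Option {u : S.GG // u ∈ Uf}) : S.GG :=
  z.elim 1 fun u => u * C.βK

variable {Uf : Finset S.GG}

lemma cell_mem_K (hL : C.Level δ) (hU : S.IsReps (S.Nk (-δ)) (S.Nk (1 - δ)) Uf)
    (z : Option {u : S.GG // u ∈ Uf}) : cell C z ∈ C.K := by
  match z with
  | none => exact C.K.one_mem
  | some u => exact C.K.mul_mem (hL.Nk_mem_K (hU.1 u.2)) hL.βK_mem_K

lemma cell_inv_mul_notMem (hL : C.Level δ) (hU : S.IsReps (S.Nk (-δ)) (S.Nk (1 - δ)) Uf)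
    (z z' : Option {u : S.GG // u ∈ Uf}) (h : z ≠ z') : (cell C z')⁻¹ * cell C z ∉ C.Iw δ := by
  match z, z' with
  | none, none => exact absurd rfl h
  | some u, none =>
    simpa [cell] using hL.mul_βK_notMem_Iw (hU.1 u.2)
  | none, some u =>
    refine fun h' => hL.mul_βK_notMem_Iw (hU.1 u.2) ?_
    simpa [cell] using Iw_inv h'
  | some u, some u' =>
    have e : (cell C (some u'))⁻¹ * cell C (some u) = C.βK * ((u' : S.GG)⁻¹ * u) * C.βK := by
      simp [cell, hL.βK_inv, mul_assoc]
    rw [e]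
    refine hL.βK_Nk_βK_notMem_Iw ((S.NkSub (-δ)).mul_mem
      ((S.NkSub (-δ)).inv_mem (hU.1 u'.2)) (hU.1 u.2)) fun h' => h ?_
    refine congrArg some (Subtype.ext ((hU.2 u' (hU.1 u'.2)).unique ⟨u.2, h'⟩ ⟨u'.2, ?_⟩))
    rw [inv_mul_cancel]
    exact (S.NkSub (1 - δ)).one_mem

lemma indRep_mem_span (hL : C.Level δ) (hff : IsFFamily C 𝔽 W σ v0 ff)
    (hv : ∀ h ∈ S.torus, ∃ c : 𝔽, sigma' C 𝔽 W σ h v0 = c • v0)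
    (hU : S.IsReps (S.Nk (-δ)) (S.Nk (1 - δ)) Uf) {g : S.GG} (hg : g ∈ C.K) :
    indRep C 𝔽 W σ g (ff 1) ∈ Submodule.span 𝔽 (Set.range fun z : Option {u : S.GG // u ∈ Uf} =>
      indRep C 𝔽 W σ (cell C z) (ff 1)) := by
  by_cases hgI : g ∈ C.Iw δ
  · obtain ⟨c, hc⟩ := hL.Iw_smul_ff hff hv hgI
    rw [hc]
    exact Submodule.smul_mem _ _ (Submodule.subset_span ⟨none, by simp [cell]⟩)
  · obtain ⟨n, hn, b, hb, rfl⟩ := hL.exists_bruhat hg hgI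
    obtain ⟨c, hc⟩ := hL.Iw_smul_ff hff hv hb
    obtain ⟨u, ⟨hu, hnu⟩, -⟩ := hU.2 n hn
    have hm : (n⁻¹ * u)⁻¹ ∈ S.Nk (1 - δ) := (S.NkSub (1 - δ)).inv_mem hnu
    have e : n * C.βK = u * C.βK * (C.βK * (n⁻¹ * u)⁻¹ * C.βK) := by
      rw [mul_inv_rev, inv_inv, mul_assoc u, ← mul_assoc C.βK, ← mul_assoc C.βK, hL.βK_mul_βK]
      group
    rw [map_mul, Module.End.mul_apply, hc, map_smul, e, map_mul, Module.End.mul_apply,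
      hff.2.2.1 1 _ (hL.βK_Nk_βK hm)]
    exact Submodule.smul_mem _ _ (Submodule.subset_span ⟨some ⟨u, hu⟩, rfl⟩)

end Chamber.Level

section FiniteField

open Polynomial

variable {k : Type*} [Field k] [Fintype k] {p n : ℕ}

lemma card_pow_add_mul_le {q : ℕ} (hq : 1 < q) (c : k) :
    Nat.card {y : k | c * y + y ^ q = 0} ≤ q := by
  have hd : (X ^ q + C c * X : k[X]).natDegree = q :=
    (natDegree_add_eq_left_of_natDegree_lt (by
      rw [natDegree_X_pow]
      exact ((natDegree_C_mul_le c X).trans natDegree_X_le).trans_lt hq)).trans (natDegree_X_pow q)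
  have h0 : (X ^ q + C c * X : k[X]) ≠ 0 := fun h => by simp [h] at hd; omega
  have hsub : {y : k | c * y + y ^ q = 0} ⊆ ((X ^ q + C c * X : k[X]).roots.toFinset : Set k) :=
    fun y hy => by simpa [h0, add_comm] using hy
  calc Nat.card {y : k | c * y + y ^ q = 0}
      ≤ Nat.card ((X ^ q + C c * X : k[X]).roots.toFinset : Set k) :=
        Nat.card_mono (Set.toFinite _) hsub
    _ = (X ^ q + C c * X : k[X]).roots.toFinset.card := Nat.card_eq_card_toFinset _ |>.trans (by simp)
    _ ≤ Multiset.card (X ^ q + C c * X : k[X]).roots := Multiset.toFinset_card_le _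
    _ ≤ q := (card_roots' _).trans_eq hd

/-- The trace `y ↦ y + y ^ q` from the field with `q ^ 2` elements has kernel of order `q`, and
its image is the subfield with `q` elements. -/
lemma card_trace_ker [Fact p.Prime] (hn : n ≠ 0) (hk : Fintype.card k = (p ^ n) ^ 2) :
    Nat.card {y : k | y + y ^ p ^ n = 0} = p ^ n ∧
      ∀ z : k, z ^ p ^ n = z → ∃ y : k, y + y ^ p ^ n = z := by
  have : CharP k p := charP_of_card_eq_prime_pow (f := n * 2) (by rw [hk, pow_mul])
  have hq : 1 < p ^ n := Nat.one_lt_pow hn (Fact.out : p.Prime).one_lt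
  let A : k →+ k := AddMonoidHom.id k + (iterateFrobenius k p n).toAddMonoidHom
  have hA : ∀ y, A y = y + y ^ p ^ n := fun y => by simp [A, iterateFrobenius_def]
  have hfrob : ∀ y : k, (y ^ p ^ n) ^ p ^ n = y := fun y => by
    rw [← pow_mul, ← sq, ← hk, FiniteField.pow_card]
  have hker : (A.ker : Set k) = {y : k | y + y ^ p ^ n = 0} := by
    ext y
    simp [AddMonoidHom.mem_ker, hA]
  have hker_le : Nat.card A.ker ≤ p ^ n := by
    change Nat.card (A.ker : Set k) ≤ _
    rw [hker]
    simpa using card_pow_add_mul_le hq (1 : k)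
  have hfix_le : Nat.card {z : k | z ^ p ^ n = z} ≤ p ^ n := by
    have := card_pow_add_mul_le hq (-1 : k)
    convert this using 4
    ext z
    rw [neg_one_mul, neg_add_eq_zero, eq_comm]
  have hsub : (A.range : Set k) ⊆ {z : k | z ^ p ^ n = z} := by
    rintro _ ⟨y, rfl⟩
    change (A y) ^ p ^ n = A y
    rw [hA, add_pow_char_pow, hfrob, add_comm]
  have hmul : Nat.card A.ker * Nat.card A.range = (p ^ n) ^ 2 := by
    rw [← hk, ← Nat.card_eq_fintype_card, mul_comm, ← Nat.card_congr
      (QuotientAddGroup.quotientKerEquivRange A).toEquiv, AddSubgroup.card_eq_card_quotient_mul_card_addSubgroup A.ker]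
  have hr_le : Nat.card A.range ≤ Nat.card {z : k | z ^ p ^ n = z} :=
    Nat.card_mono (Set.toFinite _) hsub
  have hkq : Nat.card A.ker = p ^ n := by nlinarith
  have hrq : Nat.card A.range = p ^ n := by nlinarith
  refine ⟨hker ▸ hkq, fun z hz => ?_⟩
  have heq : (A.range : Set k) = {z : k | z ^ p ^ n = z} :=
    Set.eq_of_subset_of_ncard_le hsub (by
      change Nat.card {z : k | z ^ p ^ n = z} ≤ Nat.card A.range
      omega)
  obtain ⟨y, hy⟩ := heq.ge hz
  exact ⟨y, by rw [← hA, hy]⟩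

/-- The number of points of the Heisenberg group over the field with `q ^ 2` elements. -/
lemma card_heisenberg [Fact p.Prime] (hn : n ≠ 0) (hk : Fintype.card k = (p ^ n) ^ 2) :
    Nat.card {z : k × k | z.1 * z.1 ^ p ^ n + z.2 + z.2 ^ p ^ n = 0} = (p ^ n) ^ 3 := by
  have : CharP k p := charP_of_card_eq_prime_pow (f := n * 2) (by rw [hk, pow_mul])
  obtain ⟨hker, hsurj⟩ := card_trace_ker hn hk
  have hfrob : ∀ y : k, (y ^ p ^ n) ^ p ^ n = y := fun y => by
    rw [← pow_mul, ← sq, ← hk, FiniteField.pow_card]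
  have hex : ∀ x : k, ∃ y : k, y + y ^ p ^ n = x * x ^ p ^ n := fun x =>
    hsurj _ (by rw [mul_pow, hfrob, mul_comm])
  choose t ht using hex
  let e : {z : k × k | z.1 * z.1 ^ p ^ n + z.2 + z.2 ^ p ^ n = 0} ≃
      k × {y : k | y + y ^ p ^ n = 0} :=
    { toFun := fun z => (z.1.1, ⟨z.1.2 + t z.1.1, by
        have h1 := z.2
        have h2 := ht z.1.1
        simp only [Set.mem_ofPred_eq] at h1 ⊢
        rw [add_pow_char_pow]
        linear_combination h1 + h2⟩)
      invFun := fun w => ⟨(w.1, w.2 - t w.1), by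
        have h1 := w.2.2
        have h2 := ht w.1
        simp only [Set.mem_ofPred_eq] at h1 ⊢
        rw [sub_pow_char_pow]
        linear_combination h1 - h2⟩
      left_inv := fun z => by simp
      right_inv := fun w => by simp }
  rw [Nat.card_congr e, Nat.card_prod, hker, Nat.card_eq_fintype_card, hk]
  ring

end FiniteField

namespace Setting

variable {S : Setting}

lemma mem_mI_iff {z : S.O} : z ∈ S.mI ↔ (z : S.E) ∈ S.pE 1 := by
  rw [S.hmI]
  simp [pE]

instance mI_isMaximal : S.mI.IsMaximal := by
  rw [Ideal.isMaximal_iff]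
  refine ⟨fun h => one_notMem_pE_one (mem_mI_iff.1 h), fun J x _ hx hxJ => ?_⟩
  have h := mt mem_mI_iff.2 hx
  have hi : (x : S.E)⁻¹ ∈ S.O := S.mem_pE_zero.1 (by simpa using inv_mem_pE (k := 0) (by simpa using h))
  have : (1 : S.O) = ⟨_, hi⟩ * x :=
    Subtype.ext (inv_mul_cancel₀ (ne_zero_of_notMem_pE h)).symm
  rw [this]
  exact J.mul_mem_left _ hxJ

noncomputable instance : Field S.kE := Ideal.Quotient.field S.mI

lemma card_kE : Fintype.card S.kE = (S.p ^ S.fdeg) ^ 2 := by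
  rw [← S.hq]
  exact S.card_res

lemma card_Lbig : Nat.card S.Lbig = S.q ^ 3 := by
  have : Fact S.p.Prime := ⟨S.hp⟩
  have := card_heisenberg S.hfdeg.ne' S.card_kE
  rw [← S.hq] at this
  exact this

lemma card_Lsmall : Nat.card S.Lsmall = S.q := by
  have : Fact S.p.Prime := ⟨S.hp⟩
  have := (card_trace_ker S.hfdeg.ne' S.card_kE).1
  rw [← S.hq] at this
  rw [← this]
  exact Nat.card_congr
    { toFun := fun z => ⟨z.1.2, z.2.2⟩
      invFun := fun y => ⟨(0, y), rfl, y.2⟩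
      left_inv := fun z => Subtype.ext (Prod.ext z.2.1.symm rfl)
      right_inv := fun y => rfl }

lemma inv_two_mem : (2 : S.E)⁻¹ ∈ S.pE 0 ∧ (2 : S.E) ≠ 0 := by
  have : Fact S.p.Prime := ⟨S.hp⟩
  have : CharP S.kE S.p := charP_of_card_eq_prime_pow (f := S.fdeg * 2) (by rw [card_kE, pow_mul])
  have h2 : (2 : S.E) ∉ S.pE 1 := fun h => by
    have h0 : S.resmap 2 = 0 := Ideal.Quotient.eq_zero_iff_mem.mpr (mem_mI_iff.mpr h)
    rw [map_ofNat, ← Nat.cast_ofNat, CharP.cast_eq_zero_iff S.kE S.p] at h0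
    exact S.hodd ((Nat.prime_dvd_prime_iff_eq S.hp Nat.prime_two).mp h0)
  exact ⟨by simpa using inv_mem_pE (k := 0) (by simpa using h2), ne_zero_of_notMem_pE h2⟩

lemma resmap_eq_iff {z w : S.O} : S.resmap z = S.resmap w ↔ (z : S.E) - w ∈ S.pE 1 := by
  rw [resmap, Ideal.Quotient.eq, mem_mI_iff]
  rfl

lemma resmap_conj (z : S.O) : S.resmap ⟨S.conj z, S.conj_O z z.2⟩ = S.resmap z ^ S.q :=
  S.res_frob z

/-- Lifting solutions of trace equations from the residue field. -/
lemma exists_trace_lift (b : S.kE) (e : S.O) (he : S.conj e = e)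
    (hb : S.resmap e + b + b ^ S.q = 0) :
    ∃ y : S.O, S.resmap y = b ∧ (e : S.E) + y + S.conj y = 0 := by
  obtain ⟨y, rfl⟩ := Ideal.Quotient.mk_surjective b
  change S.resmap e + S.resmap y + S.resmap y ^ S.q = 0 at hb
  rw [← resmap_conj, ← map_add, ← map_add] at hb
  have hm : (e : S.E) + y + S.conj y ∈ S.pE 1 :=
    mem_mI_iff.mp (Ideal.Quotient.eq_zero_iff_mem.mp hb)
  obtain ⟨hi, h2⟩ := S.inv_two_mem
  have hd : (2 : S.E)⁻¹ * (e + y + S.conj y) ∈ S.pE 1 := pE_mul hi hm (by norm_num)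
  have hc : S.conj (2 : S.E)⁻¹ = 2⁻¹ := by rw [map_inv₀, map_ofNat]
  refine ⟨⟨y - 2⁻¹ * (e + y + S.conj y),
    S.O.sub_mem y.2 (S.mem_pE_zero.mp (pE_mono (by norm_num) hd))⟩, ?_, ?_⟩
  · change S.resmap _ = S.resmap y
    rw [resmap_eq_iff]
    simpa using pE_neg hd
  · simp only [map_sub, map_mul, map_add, hc, S.conj_invol, he]
    field_simp
    ring

end Setting

namespace Setting

variable {S : Setting}

lemma IsReps.card_eq {A B : Subgroup S.GG} {U : Finset S.GG} (hU : S.IsReps A B U) {X : Type*}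
    (φ : A → X) (hφ : Function.Surjective φ)
    (h : ∀ a b : A, φ a = φ b ↔ (a : S.GG)⁻¹ * b ∈ B) : U.card = Nat.card X := by
  rw [← Fintype.card_coe U, ← Nat.card_eq_fintype_card]
  refine Nat.card_eq_of_bijective (fun u : U => φ ⟨u, hU.1 u.2⟩) ⟨fun u u' e => ?_, fun x => ?_⟩
  · refine Subtype.ext ((hU.2 u (hU.1 u.2)).unique ⟨u.2, ?_⟩ ⟨u'.2, (h _ _).1 e⟩)
    rw [inv_mul_cancel]
    exact B.one_mem
  · obtain ⟨a, rfl⟩ := hφ x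
    obtain ⟨u, ⟨hu, hau⟩, -⟩ := hU.2 a a.2
    exact ⟨⟨u, hu⟩, ((h _ _).2 hau).symm⟩

lemma nE_inj {x y x' y' : S.E} {h : x * S.conj x + y + S.conj y = 0}
    {h' : x' * S.conj x' + y' + S.conj y' = 0} (e : S.nE x y h = S.nE x' y' h') :
    x = x' ∧ y = y' := by
  have := congrArg S.mat e
  rw [mat_nE, mat_nE] at this
  exact ⟨by simpa [nM] using congrFun (congrFun this 0) 1,
    by simpa [nM] using congrFun (congrFun this 0) 2⟩

end Setting

namespace Chamber.Level

open Setting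

variable {S : Setting} {C : Chamber S} {δ : ℤ}

lemma nE_inv_mul_mem_iff (hL : C.Level δ) {x y x' y' : S.E} (h : x * S.conj x + y + S.conj y = 0)
    (h' : x' * S.conj x' + y' + S.conj y' = 0) (hy : y ∈ S.pE (-δ)) :
    (S.nE x y h)⁻¹ * S.nE x' y' h' ∈ S.Nk (1 - δ) ↔
      x' - x ∈ S.pE (1 - δ) ∧ y' - y ∈ S.pE (1 - δ) := by
  obtain ⟨h1, e1⟩ := nE_inv h
  obtain ⟨h2, e2⟩ := nE_mul h1 h'
  have e : S.conj y + y' - -x * S.conj x' = (y' - y) + x * S.conj (x' - x) := by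
    rw [map_sub]
    linear_combination h
  rw [e1, e2, nE_mem_Nk_iff, e]
  have hx := hL.x_mem h hy
  have key : x' - x ∈ S.pE (1 - δ) → x * S.conj (x' - x) ∈ S.pE (1 - δ) := fun hd =>
    pE_mul hx (pE_conj hd) (by omega)
  refine ⟨fun hm => ?_, fun hm => pE_add hm.2 (key hm.1)⟩
  have hd : x' - x ∈ S.pE (1 - δ) := by
    have := hL.x_mem' h2 (by rwa [e])
    rwa [neg_add_eq_sub] at this
  exact ⟨hd, by simpa using pE_sub hm (key hd)⟩

lemma card_reps (hL : C.Level δ) {U : Finset S.GG}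
    (hU : S.IsReps (S.Nk (-δ)) (S.Nk (1 - δ)) U) : U.card = S.q ^ C.tK := by
  have ht := hL.tK_eq
  choose x y h hy e using fun n : S.NkSub (-δ) => mem_Nk_iff.1 n.2
  have hx := fun n => S.mem_pE_zero.1 (hL.x_mem (h n) (hy n))
  have hrel : ∀ a b : S.NkSub (-δ), (a : S.GG)⁻¹ * b ∈ S.NkSub (1 - δ) ↔
      x b - x a ∈ S.pE (1 - δ) ∧ y b - y a ∈ S.pE (1 - δ) := fun a b => by
    rw [← hL.nE_inv_mul_mem_iff (h a) (h b) (hy a), ← e, ← e]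
    rfl
  have hcoord : ∀ (x₀ y₀ : S.E) (h₀ : x₀ * S.conj x₀ + y₀ + S.conj y₀ = 0)
      (hy₀ : y₀ ∈ S.pE (-δ)), ∃ n, x n = x₀ ∧ y n = y₀ := fun x₀ y₀ h₀ hy₀ => by
    let n : S.NkSub (-δ) := ⟨S.nE x₀ y₀ h₀, (nE_mem_Nk_iff h₀).2 hy₀⟩
    exact ⟨n, nE_inj (h' := h₀) ((e n).symm.trans rfl)⟩
  rcases hL.zero_or_one with rfl | rfl
  · have h3 : C.tK = 3 := by omega
    have hy' := fun n => S.mem_pE_zero.1 (hy n)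
    rw [h3, ← card_Lbig]
    have hU' : S.IsReps (S.NkSub (-0)) (S.NkSub (1 - 0)) U := hU
    refine hU'.card_eq (fun n => (⟨(S.resmap ⟨x n, hx n⟩, S.resmap ⟨y n, hy' n⟩), ?_⟩ : S.Lbig))
      ?_ ?_
    · change _ * _ ^ _ + _ + _ ^ _ = _
      rw [← resmap_conj, ← resmap_conj, ← map_mul, ← map_add, ← map_add, ← map_zero S.resmap]
      exact congrArg _ (Subtype.ext (h n))
    · rintro ⟨⟨a, b⟩, hab⟩
      obtain ⟨x₀, rfl⟩ := Ideal.Quotient.mk_surjective a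
      change S.resmap x₀ * S.resmap x₀ ^ S.q + b + b ^ S.q = 0 at hab
      rw [← resmap_conj, ← map_mul] at hab
      obtain ⟨y₀, rfl, h₀⟩ := exists_trace_lift b _
        (by simp [S.conj_invol, mul_comm]) hab
      obtain ⟨n, hn⟩ := hcoord x₀ y₀ h₀ (S.mem_pE_zero.2 y₀.2)
      refine ⟨n, Subtype.ext (Prod.ext ?_ ?_)⟩
      · exact congrArg S.resmap (Subtype.ext hn.1)
      · exact congrArg S.resmap (Subtype.ext hn.2)
    · intro a b
      rw [hrel, eq_comm, Subtype.mk.injEq, Prod.mk.injEq, resmap_eq_iff, resmap_eq_iff, sub_zero]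
  · have h1 : C.tK = 1 := by omega
    have hy' : ∀ n, S.ϖ * y n ∈ S.O := fun n => S.mem_pE_zero.1
      (pE_mul (by simpa using S.zpow_mem_pE 1) (hy n) (by norm_num))
    rw [h1, pow_one, ← card_Lsmall]
    have hU' : S.IsReps (S.NkSub (-1)) (S.NkSub (1 - 1)) U := hU
    have hmem : ∀ n, ((0, S.resmap ⟨S.ϖ * y n, hy' n⟩) : S.kE × S.kE) ∈ S.Lsmall := by
      refine fun n => ⟨rfl, ?_⟩
      change S.resmap _ + S.resmap _ ^ _ = _
      rw [← resmap_conj, ← map_add, resmap, Ideal.Quotient.eq_zero_iff_mem, mem_mI_iff]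
      have : S.ϖ * y n + S.conj (S.ϖ * y n) = -(S.ϖ * (x n * S.conj (x n))) := by
        rw [map_mul, S.unif_conj]
        linear_combination S.ϖ * h n
      change S.ϖ * y n + S.conj (S.ϖ * y n) ∈ _
      rw [this]
      exact pE_neg (pE_mul (l := 0) (by simpa using S.zpow_mem_pE 1)
        (S.mem_pE_zero.2 (S.O.mul_mem (hx n) (S.conj_O _ (hx n)))) (by norm_num))
    refine hU'.card_eq (fun n => (⟨_, hmem n⟩ : S.Lsmall)) ?_ ?_
    · rintro ⟨⟨a, b⟩, ha, hb⟩
      obtain rfl : a = 0 := ha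
      change b + b ^ S.q = 0 at hb
      obtain ⟨z, rfl, hz⟩ := exists_trace_lift b 0 (by simp) (by simpa using hb)
      rw [ZeroMemClass.coe_zero] at hz
      obtain ⟨n, -, hn⟩ := hcoord 0 (S.ϖ⁻¹ * z) (by
          rw [map_mul, map_inv₀, S.unif_conj]
          linear_combination S.ϖ⁻¹ * hz)
        (pE_mul (l := 0) (by simpa using S.zpow_mem_pE (-1)) (S.mem_pE_zero.2 z.2) (by norm_num))
      refine ⟨n, Subtype.ext (Prod.ext rfl (congrArg S.resmap (Subtype.ext ?_)))⟩
      change S.ϖ * y n = z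
      rw [hn, mul_inv_cancel_left₀ S.unif_ne]
    · intro a b
      rw [hrel, eq_comm, Subtype.mk.injEq, Prod.mk.injEq, resmap_eq_iff]
      change _ ∧ S.ϖ * y b - S.ϖ * y a ∈ S.pE 1 ↔ _
      rw [← mul_sub]
      have hxd : x b - x a ∈ S.pE (1 - 1) :=
        S.mem_pE_zero.2 (S.O.sub_mem (hx b) (hx a))
      simp only [true_and, hxd]
      refine ⟨fun hm => ?_, fun hm => ?_⟩
      · have := pE_mul (m := 1 - 1) (S.zpow_mem_pE (-1)) hm (by norm_num)
        rwa [zpow_neg_one, inv_mul_cancel_left₀ S.unif_ne] at this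
      · exact pE_mul (by simpa using S.zpow_mem_pE 1) hm (by norm_num)

lemma card_quot (hL : C.Level δ) {U : Finset S.GG}
    (hU : S.IsReps (S.Nk (-δ)) (S.Nk (1 - δ)) U) : Nat.card (quot S δ) = S.q ^ C.tK := by
  have hU' : S.IsReps (S.NkSub (-δ)) (S.NkSub (1 - δ)) U := hU
  rw [← hL.card_reps hU]
  exact (hU'.card_eq (QuotientGroup.mk : _ → quot S δ) QuotientGroup.mk_surjective fun a b =>
    QuotientGroup.eq).symm

end Chamber.Level

/-- The `K`-subrepresentation of `ind_K^G σ` generated by `f₁` has basis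
`{f₁} ∪ {u β_K f₁ : u ∈ N_{n_K}/N_{n_K+1}}`; in particular it has dimension `q^{t_K}+1`. -/
theorem stmt12
    (S : Setting) (C : Chamber S)
    (𝔽 : Type) [Field 𝔽] [IsAlgClosed 𝔽] [Algebra (ZMod S.p) 𝔽]
    [Algebra.IsAlgebraic (ZMod S.p) 𝔽]
    (W : Type) [AddCommGroup W] [Module 𝔽 W]
    (σ : Representation 𝔽 ↥C.K W) (hσ : IsWeight C 𝔽 W σ)
    (v0 : W) (ff : ℤ → ↥(IndSub C 𝔽 W σ)) (hff : IsFFamily C 𝔽 W σ v0 ff)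
    (Uf : Finset S.GG) (hU : S.IsReps (S.Nk C.nK) (S.Nk (C.nK + 1)) Uf) :
    LinearIndependent 𝔽 (fun z : Option {u : S.GG // u ∈ Uf} =>
      Option.elim z (ff 1) (fun u => indRep C 𝔽 W σ (↑u * C.βK) (ff 1))) ∧
    Submodule.span 𝔽 (Set.range (fun z : Option {u : S.GG // u ∈ Uf} =>
      Option.elim z (ff 1) (fun u => indRep C 𝔽 W σ (↑u * C.βK) (ff 1)))) =
      orbitSpanOn 𝔽 (indRep C 𝔽 W σ) ↑C.K (ff 1) ∧
    Module.finrank 𝔽 ↥(orbitSpanOn 𝔽 (indRep C 𝔽 W σ) ↑C.K (ff 1)) = S.q ^ C.tK + 1 := by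
  obtain ⟨δ, hL⟩ := C.exists_level
  rw [hL.nK_eq, show -δ + 1 = 1 - δ by ring] at hU
  have : Fact S.p.Prime := ⟨S.hp⟩
  have : CharP 𝔽 S.p := charP_of_injective_algebraMap (algebraMap (ZMod S.p) 𝔽).injective S.p
  have ht : C.tK ≠ 0 := by
    have := hL.tK_eq
    rcases hL.zero_or_one with rfl | rfl <;> omega
  have hQ : Nat.card (Chamber.Level.quot S δ) = S.p ^ (S.fdeg * C.tK) := by
    rw [hL.card_quot hU, S.hq, pow_mul]
  have hv : ∀ h ∈ S.torus, ∃ c, sigma' C 𝔽 W σ h v0 = c • v0 := fun h hh =>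
    hL.torus_smul hσ (mul_ne_zero S.hfdeg.ne' ht) hQ hff.1 hff.2.1 hh
  have hfam : (fun z : Option {u : S.GG // u ∈ Uf} =>
      Option.elim z (ff 1) (fun u => indRep C 𝔽 W σ (↑u * C.βK) (ff 1))) =
      fun z => indRep C 𝔽 W σ (Chamber.Level.cell C z) (ff 1) := by
    funext z
    cases z with
    | none => exact (congrArg (· (ff 1)) (map_one (indRep C 𝔽 W σ))).symm
    | some u => rfl
  rw [hfam]
  have hli : LinearIndependent 𝔽 fun z : Option {u : S.GG // u ∈ Uf} =>
      indRep C 𝔽 W σ (Chamber.Level.cell C z) (ff 1) :=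
    Chamber.Level.linearIndependent_translates hL hff _ (fun z => Chamber.Level.cell_mem_K hL hU z)
      fun z z' h => Chamber.Level.cell_inv_mul_notMem hL hU z z' h
  have hspan : Submodule.span 𝔽 (Set.range fun z : Option {u : S.GG // u ∈ Uf} =>
      indRep C 𝔽 W σ (Chamber.Level.cell C z) (ff 1)) = orbitSpanOn 𝔽 (indRep C 𝔽 W σ) ↑C.K (ff 1) := by
    refine le_antisymm (Submodule.span_mono ?_) (Submodule.span_le.2 ?_)
    · rintro _ ⟨z, rfl⟩
      exact ⟨Chamber.Level.cell C z, Chamber.Level.cell_mem_K hL hU z, rfl⟩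
    · rintro _ ⟨g, hg, rfl⟩
      exact Chamber.Level.indRep_mem_span hL hff hv hU hg
  refine ⟨hli, hspan, ?_⟩
  rw [← hspan, finrank_span_eq_card hli, Fintype.card_option, Fintype.card_coe, hL.card_reps hU]

end U21
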